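/- arXiv:2106.01715 — 3 statements merged into one kernel-verified Lean document; each statement's English description precedes it below -/
import Mathlib

section
/- Let f ∈ S₀^ev. The function z ↦ ∫₀^∞ E(f)(u) u^{-iz} d*u, initially defined for Im(z) > 1/2, extends holomorphically to the half-plane Im(z) > -1/2, and the identity ∫₀^∞ E(f)(u) u^{-iz} d*u = ζ(1/2-iz)·ψ(z) holds for all real z, where ψ(z) = ∫₀^∞ f(u)u^{1/2-iz}d*u. -/
open MeasureTheory Set Complex

/-- The space `S₀^ev` of even real Schwartz functions with `f(0) = 0` and `∫ f = 0`. -/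
def S0ev : Set (SchwartzMap ℝ ℝ) :=
  {f | (∀ x, f (-x) = f x) ∧ f 0 = 0 ∧ (∫ x : ℝ, f x) = 0}

open Filter Topology Asymptotics

/-- The sum `∑ f((n+1)u)`. -/
noncomputable def sumF (f : SchwartzMap ℝ ℝ) (u : ℝ) : ℝ := ∑' n : ℕ, f (((n : ℝ) + 1) * u)

lemma sch_decay (f : SchwartzMap ℝ ℝ) (k : ℕ) :
    ∃ C : ℝ, 0 < C ∧ ∀ x : ℝ, 0 < x → |f x| ≤ C * x⁻¹ ^ k := by
  obtain ⟨C, hC, h⟩ := f.decay k 0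
  refine ⟨C, hC, fun x hx => ?_⟩
  have := h x
  rw [norm_iteratedFDeriv_zero, Real.norm_eq_abs, Real.norm_eq_abs, abs_of_pos hx] at this
  rw [inv_pow, ← div_eq_mul_inv, le_div_iff₀ (by positivity)]
  linarith

lemma summable_inv (k : ℕ) (hk : 2 ≤ k) : Summable (fun n : ℕ => (((n : ℝ) + 1)⁻¹) ^ k) := by
  have h := (summable_nat_add_iff 1).2 (Real.summable_nat_pow_inv.2 (show 1 < k by omega))
  simpa using h

lemma term_bound (f : SchwartzMap ℝ ℝ) (k : ℕ) :
    ∃ C : ℝ, 0 < C ∧ ∀ u : ℝ, 0 < u → ∀ n : ℕ,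
      |f (((n : ℝ) + 1) * u)| ≤ C * u⁻¹ ^ k * (((n : ℝ) + 1)⁻¹) ^ k := by
  obtain ⟨C, hC, h⟩ := sch_decay f k
  refine ⟨C, hC, fun u hu n => (h _ (by positivity)).trans_eq ?_⟩
  rw [mul_inv, mul_pow]; ring

lemma summable_term (f : SchwartzMap ℝ ℝ) (u : ℝ) (hu : 0 < u) :
    Summable (fun n : ℕ => f (((n : ℝ) + 1) * u)) := by
  obtain ⟨C, hC, h⟩ := term_bound f 2
  exact Summable.of_norm_bounded ((summable_inv 2 le_rfl).mul_left _) (h u hu)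

lemma sumF_bound (f : SchwartzMap ℝ ℝ) (k : ℕ) (hk : 2 ≤ k) :
    ∃ C : ℝ, ∀ u : ℝ, 0 < u → |sumF f u| ≤ C * u⁻¹ ^ k := by
  obtain ⟨C, hC, h⟩ := term_bound f k
  refine ⟨C * ∑' n : ℕ, (((n : ℝ) + 1)⁻¹) ^ k, fun u hu => ?_⟩
  have := tsum_of_norm_bounded (f := fun n : ℕ => f (((n : ℝ) + 1) * u)) ((summable_inv k hk).mul_left (C * u⁻¹ ^ k)).hasSum (h u hu)
  rw [tsum_mul_left] at this
  calc |sumF f u| ≤ _ := this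
    _ = _ := by ring

lemma sumF_cont (f : SchwartzMap ℝ ℝ) : ContinuousOn (sumF f) (Ioi 0) := by
  obtain ⟨C, hC, h⟩ := term_bound f 2
  intro x hx
  have hx : 0 < x := hx
  have : ContinuousOn (sumF f) (Ioi (x / 2)) := by
    apply continuousOn_tsum (u := fun n : ℕ => C * (x/2)⁻¹ ^ 2 * (((n : ℝ) + 1)⁻¹) ^ 2)
    · intro n
      exact (f.continuous.comp (continuous_const.mul continuous_id)).continuousOn
    · exact (summable_inv 2 le_rfl).mul_left _
    · intro n u hu
      have hu : x / 2 < u := hu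
      refine (h u (by linarith) n).trans ?_
      have hu0 : 0 ≤ u⁻¹ := inv_nonneg.2 (by linarith)
      gcongr
  exact (this.continuousAt (Ioi_mem_nhds (by linarith))).continuousWithinAt

lemma riemann_step (f : SchwartzMap ℝ ℝ) (a b : ℝ) (hab : a ≤ b) :
    |(b - a) * f b - ∫ x in a..b, f x| ≤ (b - a) * ∫ x in a..b, |deriv f x| := by
  have hd : Continuous (deriv f) := (SchwartzMap.derivCLM ℝ ℝ f).continuous
  have h1 : (b - a) * f b - ∫ x in a..b, f x = ∫ x in a..b, (f b - f x) := by
    rw [intervalIntegral.integral_sub (by simp) (f.continuous.intervalIntegrable _ _)]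
    simp
  rw [h1]
  have h2 := intervalIntegral.norm_integral_le_of_norm_le_const (a := a) (b := b)
    (f := fun x => f b - f x) (C := ∫ x in a..b, |deriv f x|) ?_
  · rw [abs_of_nonneg (sub_nonneg.2 hab), mul_comm] at h2
    exact h2
  · intro x hx
    rw [uIoc_of_le hab] at hx
    have h3 : ∫ y in x..b, deriv f y = f b - f x :=
      intervalIntegral.integral_deriv_eq_sub (fun y _ => f.differentiableAt)
        (hd.intervalIntegrable _ _)
    rw [← h3]
    refine (intervalIntegral.norm_integral_le_integral_norm hx.2).trans ?_
    have h4 := intervalIntegral.integral_add_adjacent_intervals (μ := volume)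
      (hd.abs.intervalIntegrable a x) (hd.abs.intervalIntegrable x b)
    have h5 : 0 ≤ ∫ y in a..x, |deriv f y| :=
      intervalIntegral.integral_nonneg hx.1.le (fun _ _ => abs_nonneg _)
    simp only [Real.norm_eq_abs]
    linarith

lemma half_int (f : SchwartzMap ℝ ℝ) (hf : f ∈ S0ev) : ∫ x in Ioi (0:ℝ), f x = 0 := by
  obtain ⟨h1, -, h3⟩ := hf
  have := integral_comp_abs (f := f)
  have h4 : ∀ x : ℝ, f |x| = f x := by
    intro x
    rcases abs_choice x with h | h <;> rw [h]
    exact h1 x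
  simp only [h4, h3] at this
  linarith

lemma sumF_bdd (f : SchwartzMap ℝ ℝ) (hf : f ∈ S0ev) (u : ℝ) (hu : 0 < u) :
    |sumF f u| ≤ ∫ x, |deriv f x| := by
  have hd : Continuous (deriv f) := (SchwartzMap.derivCLM ℝ ℝ f).continuous
  have hdi : Integrable (fun x => |deriv f x|) := (SchwartzMap.derivCLM ℝ ℝ f).integrable.abs
  have key : ∀ N : ℕ, |u * ∑ n ∈ Finset.range N, f (((n : ℝ) + 1) * u) -
      ∫ x in (0:ℝ)..(N * u), f x| ≤ u * ∫ x, |deriv f x| := by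
    intro N
    have e1 := intervalIntegral.sum_integral_adjacent_intervals (μ := volume) (f := f)
      (a := fun n : ℕ => (n : ℝ) * u) (n := N) (fun k _ => f.continuous.intervalIntegrable _ _)
    have e2 := intervalIntegral.sum_integral_adjacent_intervals (μ := volume)
      (f := fun x => |deriv f x|)
      (a := fun n : ℕ => (n : ℝ) * u) (n := N) (fun k _ => hd.abs.intervalIntegrable _ _)
    simp only [Nat.cast_zero, zero_mul, Nat.cast_add, Nat.cast_one] at e1 e2
    rw [← e1, Finset.mul_sum, ← Finset.sum_sub_distrib]
    refine (Finset.abs_sum_le_sum_abs _ _).trans ?_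
    have e3 : ∀ n ∈ Finset.range N, |u * f (((n : ℝ) + 1) * u) -
        ∫ x in ((n:ℝ) * u)..(((n:ℝ)+1) * u), f x| ≤
        u * ∫ x in ((n:ℝ) * u)..(((n:ℝ)+1) * u), |deriv f x| := by
      intro n _
      have := riemann_step f ((n:ℝ) * u) (((n:ℝ)+1) * u) (by nlinarith)
      rwa [show ((n:ℝ)+1) * u - (n:ℝ) * u = u by ring] at this
    refine (Finset.sum_le_sum e3).trans ?_
    rw [← Finset.mul_sum, e2]
    gcongr
    rw [intervalIntegral.integral_of_le (by positivity)]
    exact setIntegral_le_integral hdi (Eventually.of_forall fun _ => abs_nonneg _)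
  have t1 : Tendsto (fun N : ℕ => ∑ n ∈ Finset.range N, f (((n : ℝ) + 1) * u)) atTop
      (𝓝 (sumF f u)) := (summable_term f u hu).hasSum.tendsto_sum_nat
  have t2 : Tendsto (fun N : ℕ => ∫ x in (0:ℝ)..((N : ℝ) * u), f x) atTop (𝓝 0) := by
    have := intervalIntegral_tendsto_integral_Ioi (μ := volume) (f := f) 0
      f.integrable.integrableOn
      (tendsto_natCast_atTop_atTop.atTop_mul_const hu : Tendsto (fun N : ℕ => (N : ℝ) * u) _ _)
    rwa [half_int f hf] at this
  have t3 := ((t1.const_mul u).sub t2).abs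
  have := le_of_tendsto' t3 key
  rw [sub_zero, abs_mul, abs_of_pos hu] at this
  exact le_of_mul_le_mul_left this hu

lemma isBigO_top_of (g : ℝ → ℝ) (k : ℕ) (h : ∃ C : ℝ, ∀ u : ℝ, 0 < u → |g u| ≤ C * u⁻¹ ^ k) :
    (fun u => (g u : ℂ)) =O[atTop] (fun u : ℝ => u ^ (-(k : ℝ))) := by
  obtain ⟨C, h⟩ := h
  refine IsBigO.of_bound C ?_
  filter_upwards [eventually_gt_atTop 0] with u hu
  rw [Complex.norm_real, Real.norm_eq_abs, Real.norm_of_nonneg (by positivity),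
    Real.rpow_neg hu.le, Real.rpow_natCast, ← inv_pow]
  exact h u hu

lemma isBigO_zero_of (g : ℝ → ℝ) (h : ∃ C : ℝ, ∀ u : ℝ, 0 < u → |g u| ≤ C) :
    (fun u => (g u : ℂ)) =O[𝓝[>] 0] (fun u : ℝ => u ^ (-(0 : ℝ))) := by
  obtain ⟨C, h⟩ := h
  refine IsBigO.of_bound C ?_
  filter_upwards [self_mem_nhdsWithin] with u hu
  simpa using h u hu

lemma locInt_of (g : ℝ → ℝ) (h : ContinuousOn g (Ioi 0)) :
    LocallyIntegrableOn (fun u => (g u : ℂ)) (Ioi 0) :=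
  (Complex.continuous_ofReal.comp_continuousOn h).locallyIntegrableOn measurableSet_Ioi

lemma f_bdd (f : SchwartzMap ℝ ℝ) : ∃ C : ℝ, ∀ u : ℝ, 0 < u → |f u| ≤ C := by
  obtain ⟨C, _, h⟩ := sch_decay f 0
  exact ⟨C, fun u hu => by simpa using h u hu⟩

lemma f_conv (f : SchwartzMap ℝ ℝ) (w : ℂ) (hw : 0 < w.re) :
    MellinConvergent (fun u => (f u : ℂ)) w := by
  obtain ⟨k, hk⟩ := exists_nat_gt w.re
  obtain ⟨C, _, h⟩ := sch_decay f k
  exact mellinConvergent_of_isBigO_rpow (locInt_of f f.continuous.continuousOn)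
    (isBigO_top_of f k ⟨C, h⟩) hk (isBigO_zero_of f (f_bdd f)) hw

lemma f_diff (f : SchwartzMap ℝ ℝ) (w : ℂ) (hw : 0 < w.re) :
    DifferentiableAt ℂ (mellin (fun u => (f u : ℂ))) w := by
  obtain ⟨k, hk⟩ := exists_nat_gt w.re
  obtain ⟨C, _, h⟩ := sch_decay f k
  exact mellin_differentiableAt_of_isBigO_rpow (locInt_of f f.continuous.continuousOn)
    (isBigO_top_of f k ⟨C, h⟩) hk (isBigO_zero_of f (f_bdd f)) hw

lemma F_diff (f : SchwartzMap ℝ ℝ) (hf : f ∈ S0ev) (w : ℂ) (hw : 0 < w.re) :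
    DifferentiableAt ℂ (mellin (fun u => (sumF f u : ℂ))) w := by
  obtain ⟨k, hk⟩ := exists_nat_gt w.re
  have hk' : w.re < ((k + 2 : ℕ) : ℝ) := by push_cast; linarith
  exact mellin_differentiableAt_of_isBigO_rpow (locInt_of _ (sumF_cont f))
    (isBigO_top_of _ (k + 2) (sumF_bound f _ (by omega))) hk'
    (isBigO_zero_of _ ⟨_, sumF_bdd f hf⟩) hw

lemma mellin_eq (f : SchwartzMap ℝ ℝ) (w : ℂ) (hw : 1 < w.re) :
    mellin (fun u => (sumF f u : ℂ)) w = riemannZeta w * mellin (fun u => (f u : ℂ)) w := by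
  have hpos : ∀ n : ℕ, (0:ℝ) < (n:ℝ) + 1 := fun n => by positivity
  have hc := f_conv f w (by linarith)
  have H := hasSum_integral_of_summable_integral_norm (μ := volume.restrict (Ioi (0:ℝ)))
    (F := fun (n : ℕ) (t : ℝ) => (t : ℂ) ^ (w - 1) • ((f (((n:ℝ) + 1) * t) : ℝ) : ℂ)) ?_ ?_
  · have e1 : ∫ t in Ioi (0:ℝ), (∑' n : ℕ, (t : ℂ) ^ (w - 1) • ((f (((n:ℝ) + 1) * t) : ℝ) : ℂ))
        = mellin (fun u => (sumF f u : ℂ)) w := by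
      rw [mellin]
      congr 1
      ext t
      simp only [smul_eq_mul]
      rw [tsum_mul_left, sumF, Complex.ofReal_tsum]
    rw [e1] at H
    rw [← H.tsum_eq, zeta_eq_tsum_one_div_nat_add_one_cpow hw, ← tsum_mul_right]
    congr 1
    ext n
    have := mellin_comp_mul_left (fun u => (f u : ℂ)) w (hpos n)
    rw [mellin] at this
    rw [this, smul_eq_mul, Complex.cpow_neg]
    push_cast
    rw [one_div]
  · intro n
    exact (MellinConvergent.comp_mul_left (hpos n)).2 hc
  · have e2 : ∀ n : ℕ, ∫ t in Ioi (0:ℝ), ‖(t : ℂ) ^ (w - 1) • ((f (((n:ℝ) + 1) * t) : ℝ) : ℂ)‖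
        = ((n:ℝ)+1) ^ (-w.re) * ∫ t in Ioi (0:ℝ), ‖(t : ℂ) ^ (w - 1) • (f t : ℂ)‖ := by
      intro n
      have e3 := integral_comp_mul_left_Ioi (fun t : ℝ => ‖(t : ℂ) ^ (w - 1) • (f t : ℂ)‖) 0 (hpos n)
      rw [mul_zero, smul_eq_mul] at e3
      have e4 : ((n:ℝ)+1) ^ (-w.re) = ((n:ℝ)+1) ^ (1 - w.re) * ((n:ℝ)+1)⁻¹ := by
        rw [← Real.rpow_neg_one, ← Real.rpow_add (hpos n)]; congr 1; ring
      rw [e4, mul_assoc, ← e3, ← integral_const_mul]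
      refine setIntegral_congr_fun measurableSet_Ioi fun t ht => ?_
      have ht : 0 < t := ht
      simp only [norm_smul]
      rw [Complex.norm_cpow_eq_rpow_re_of_pos ht,
        Complex.norm_cpow_eq_rpow_re_of_pos (mul_pos (hpos n) ht),
        Real.mul_rpow (hpos n).le ht.le, ← mul_assoc, ← mul_assoc, ← Real.rpow_add (hpos n)]
      simp
    simp only [e2]
    refine Summable.mul_right _ ?_
    have h := (summable_nat_add_iff 1).2 (Real.summable_nat_rpow.2 (show -w.re < -1 by linarith))
    simpa using h

/-- The entire function `(s-1)ζ(s)`. -/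
noncomputable def zeta1 : ℂ → ℂ := Function.update (fun s ↦ (s - 1) * riemannZeta s) 1 1

lemma zeta1_of_ne (w : ℂ) (h : w ≠ 1) : zeta1 w = (w - 1) * riemannZeta w := by
  simp [zeta1, h]

lemma zeta1_diff : Differentiable ℂ zeta1 := by
  have hne : ∀ w : ℂ, w ≠ 1 → DifferentiableAt ℂ zeta1 w := by
    intro w h
    have : DifferentiableAt ℂ (fun s ↦ (s - 1) * riemannZeta s) w :=
      (differentiableAt_id.sub_const 1).mul (differentiableAt_riemannZeta h)
    refine this.congr_of_eventuallyEq ?_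
    filter_upwards [isOpen_ne.mem_nhds h] with s hs using zeta1_of_ne s hs
  intro w
  by_cases h : w = 1
  · subst h
    refine (analyticAt_of_differentiable_on_punctured_nhds_of_continuousAt ?_ ?_).differentiableAt
    · filter_upwards [self_mem_nhdsWithin] with t ht using hne t ht
    · exact continuousAt_update_same.2 riemannZeta_residue_one
  · exact hne w h

lemma mellin_eq' (f : SchwartzMap ℝ ℝ) (hf : f ∈ S0ev) (w : ℂ) (hw : 0 < w.re) (hw1 : w ≠ 1) :
    mellin (fun u => (sumF f u : ℂ)) w = riemannZeta w * mellin (fun u => (f u : ℂ)) w := by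
  have hU : IsOpen {w : ℂ | 0 < w.re} := isOpen_lt continuous_const continuous_re
  have hconv : IsPreconnected {w : ℂ | 0 < w.re} := (convex_halfSpace_re_gt 0).isPreconnected
  have hA : AnalyticOnNhd ℂ (fun w => (w - 1) * mellin (fun u => (sumF f u : ℂ)) w)
      {w : ℂ | 0 < w.re} := DifferentiableOn.analyticOnNhd (fun w hw =>
        ((differentiableAt_id.sub_const 1).mul (F_diff f hf w hw)).differentiableWithinAt) hU
  have hB : AnalyticOnNhd ℂ (fun w => zeta1 w * mellin (fun u => (f u : ℂ)) w)
      {w : ℂ | 0 < w.re} := DifferentiableOn.analyticOnNhd (fun w hw =>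
        ((zeta1_diff w).mul (f_diff f w hw)).differentiableWithinAt) hU
  have := hA.eqOn_of_preconnected_of_eventuallyEq hB hconv (z₀ := 2) (by simp) ?_ hw
  · simp only [zeta1_of_ne w hw1, mul_assoc] at this
    exact mul_left_cancel₀ (sub_ne_zero.2 hw1) this
  · have h2 : {w : ℂ | 1 < w.re} ∈ 𝓝 (2:ℂ) :=
      (isOpen_lt continuous_const continuous_re).mem_nhds (by simp)
    filter_upwards [h2] with w hw
    have hw' : w ≠ 1 := by rintro rfl; simp at hw
    rw [mellin_eq f w hw, zeta1_of_ne w hw', mul_assoc]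

lemma lhs_eq (f : SchwartzMap ℝ ℝ) (z : ℂ) :
    (∫ u in Set.Ioi (0:ℝ),
        ((Real.sqrt u * ∑' n : ℕ, f (((n : ℝ) + 1) * u) : ℝ) : ℂ) *
          (u : ℂ) ^ (-(Complex.I * z)) / (u : ℂ)) =
      mellin (fun u => (sumF f u : ℂ)) (1 / 2 - Complex.I * z) := by
  rw [mellin]
  refine setIntegral_congr_fun measurableSet_Ioi fun u hu => ?_
  have hu : 0 < u := hu
  have hu' : (u : ℂ) ≠ 0 := by exact_mod_cast hu.ne'
  have e : ((Real.sqrt u : ℝ) : ℂ) = (u : ℂ) ^ (1 / 2 : ℂ) := by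
    rw [Real.sqrt_eq_rpow, Complex.ofReal_cpow hu.le]; simp
  simp only [smul_eq_mul]
  rw [Complex.ofReal_mul, e, Complex.cpow_sub _ _ hu', Complex.cpow_one,
    sub_eq_add_neg (1 / 2 : ℂ), Complex.cpow_add _ _ hu', sumF]
  ring

/-- `z ↦ ∫₀^∞ E(f)(u) u^{-iz} d*u` is holomorphic on `Im z > -1/2`, and the
identity `∫₀^∞ E(f)(u) u^{-iz} d*u = ζ(1/2 - iz) ψ(z)` holds for all real `z`. -/
theorem stmt6 (f : SchwartzMap ℝ ℝ) (hf : f ∈ S0ev) :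
    DifferentiableOn ℂ
      (fun z : ℂ => ∫ u in Set.Ioi (0:ℝ),
        ((Real.sqrt u * ∑' n : ℕ, f (((n : ℝ) + 1) * u) : ℝ) : ℂ) *
          (u : ℂ) ^ (-(Complex.I * z)) / (u : ℂ))
      {z : ℂ | -(1 / 2 : ℝ) < z.im} ∧
    ∀ s : ℝ,
      (∫ u in Set.Ioi (0:ℝ),
        ((Real.sqrt u * ∑' n : ℕ, f (((n : ℝ) + 1) * u) : ℝ) : ℂ) *
          (u : ℂ) ^ (-(Complex.I * (s : ℂ))) / (u : ℂ)) =
      riemannZeta (1 / 2 - Complex.I * s) *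
        ∫ u in Set.Ioi (0:ℝ),
          (f u : ℂ) * (u : ℂ) ^ ((1 : ℂ) / 2 - Complex.I * (s : ℂ)) / (u : ℂ) := by
  simp only [lhs_eq]
  constructor
  · intro z hz
    have hz : -(1 / 2 : ℝ) < z.im := hz
    have h := F_diff f hf (1 / 2 - Complex.I * z) (by simp; linarith)
    exact (h.comp z (f := fun z : ℂ => 1 / 2 - Complex.I * z) (by fun_prop)).differentiableWithinAt
  · intro s
    rw [mellin_eq' f hf (1 / 2 - Complex.I * s) (by simp) ?_]
    · congr 1
      rw [mellin]
      refine setIntegral_congr_fun measurableSet_Ioi fun u hu => ?_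
      have hu : 0 < u := hu
      have hu' : (u : ℂ) ≠ 0 := by exact_mod_cast hu.ne'
      simp only [smul_eq_mul]
      rw [Complex.cpow_sub _ _ hu', Complex.cpow_one]
      ring
    · intro h
      have := congrArg Complex.re h
      norm_num at this
end

section
/- Let C = ℝ₊*/μ^ℤ be a ζ-cycle, i.e. Σ_μE(S₀^ev) is not dense in L²(C). Then every character χ(u) = u^{is} (with μ^{is}=1) occurring in the spectrum of the rotation action of ℝ₊* on the orthogonal complement of Σ_μE(S₀^ev) in L²(C) satisfies ζ(1/2 + is) = 0. -/
open MeasureTheory Set Complex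

/-- `Σ_μ E(f)(u) = ∑_{k∈ℤ} (μ^k u)^{1/2} ∑_{n≥1} f(n μ^k u)`. -/
noncomputable def SigmaE (μ : ℝ) (f : SchwartzMap ℝ ℝ) (u : ℝ) : ℝ :=
  ∑' k : ℤ, Real.sqrt (μ ^ k * u) * ∑' n : ℕ, f (((n : ℝ) + 1) * (μ ^ k * u))

/-- The measure `d*u = du/u` on the fundamental domain `(1, μ]` of `ℝ₊*/μ^ℤ`;
`L²` of this measure is `L²(C)` for the circle `C = ℝ₊*/μ^ℤ` of length `log μ`. -/
noncomputable def mulHaarOn (μ : ℝ) : Measure ℝ :=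
  (volume.restrict (Set.Ioc (1:ℝ) μ)).withDensity fun u => ENNReal.ofReal u⁻¹

/-- The circle `C = ℝ₊*/μ^ℤ` is a ζ-cycle when `Σ_μ E(S₀^ev)` is not dense in `L²(C)`,
equivalently when some nonzero `g ∈ L²(C)` is orthogonal to all `Σ_μ E(f)`, `f ∈ S₀^ev`. -/
noncomputable def IsZetaCycle (μ : ℝ) : Prop :=
  ∃ g : Lp ℂ 2 (mulHaarOn μ), g ≠ 0 ∧
    ∀ f ∈ S0ev, (∫ u, (starRingEnd ℂ) (g u) * (SigmaE μ f u : ℂ) ∂(mulHaarOn μ)) = 0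


/-- Polynomials grow at most like `exp |x|`. -/
lemma poly_le_exp_abs (P : Polynomial ℝ) :
    ∃ C : ℝ, 0 ≤ C ∧ ∀ x : ℝ, |P.eval x| ≤ C * Real.exp |x| := by
  induction P using Polynomial.induction_on' with
  | add p q hp hq =>
    obtain ⟨C, hC, h⟩ := hp
    obtain ⟨D, hD, h'⟩ := hq
    refine ⟨C + D, by positivity, fun x => ?_⟩
    rw [Polynomial.eval_add, add_mul]
    exact (abs_add_le _ _).trans (add_le_add (h x) (h' x))
  | monomial n a =>
    refine ⟨|a| * (n.factorial : ℝ), by positivity, fun x => ?_⟩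
    rw [Polynomial.eval_monomial, abs_mul, abs_pow, mul_assoc]
    refine mul_le_mul_of_nonneg_left ?_ (abs_nonneg a)
    have := Real.pow_div_factorial_le_exp |x| (abs_nonneg x) n
    rw [div_le_iff₀ (by positivity)] at this
    linarith

lemma iteratedDeriv_gauss (b : ℝ) (n : ℕ) :
    ∃ P : Polynomial ℝ, iteratedDeriv n (fun x : ℝ => Real.exp (-b * x ^ 2)) =
      fun x => P.eval x * Real.exp (-b * x ^ 2) := by
  induction n with
  | zero => exact ⟨1, by simp [iteratedDeriv_zero]⟩
  | succ n ih =>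
    obtain ⟨P, hP⟩ := ih
    refine ⟨Polynomial.derivative P + P * (Polynomial.C (-2 * b) * Polynomial.X), ?_⟩
    rw [iteratedDeriv_succ, hP]
    funext x
    have h1 : HasDerivAt (fun x : ℝ => Real.exp (-b * x ^ 2))
        (Real.exp (-b * x ^ 2) * (-b * (2 * x))) x := by
      have := ((hasDerivAt_pow 2 x).const_mul (-b)).exp
      simpa using this
    have h2 := (P.hasDerivAt x).mul h1
    have h3 := h2.deriv
    simp only [Polynomial.eval_add, Polynomial.eval_mul, Polynomial.eval_C, Polynomial.eval_X]
    refine Eq.trans h3 ?_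
    ring

/-- The Gaussian `exp (-b x²)` as a Schwartz function. -/
noncomputable def gaussS (b : ℝ) (hb : 1 ≤ b) : SchwartzMap ℝ ℝ where
  toFun x := Real.exp (-b * x ^ 2)
  smooth' := by fun_prop
  decay' := by
    intro k n
    obtain ⟨P, hP⟩ := iteratedDeriv_gauss b n
    obtain ⟨C, hC, h⟩ := poly_le_exp_abs (Polynomial.X ^ k * P)
    refine ⟨C * Real.exp 1, fun x => ?_⟩
    rw [norm_iteratedFDeriv_eq_norm_iteratedDeriv, hP]
    have h1 := h x
    rw [Polynomial.eval_mul, Polynomial.eval_pow, Polynomial.eval_X, abs_mul, abs_pow] at h1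
    rw [norm_mul, Real.norm_eq_abs, Real.norm_eq_abs, Real.norm_eq_abs, Real.abs_exp, ← mul_assoc]
    calc |x| ^ k * |P.eval x| * Real.exp (-b * x ^ 2)
        ≤ C * Real.exp |x| * Real.exp (-b * x ^ 2) :=
          mul_le_mul_of_nonneg_right h1 (Real.exp_pos _).le
      _ = C * Real.exp (|x| + -b * x ^ 2) := by rw [Real.exp_add]; ring
      _ ≤ C * Real.exp 1 := by
          refine mul_le_mul_of_nonneg_left (Real.exp_le_exp.mpr ?_) hC
          rw [← sq_abs x]
          nlinarith [sq_nonneg (|x| - 1), mul_nonneg (sub_nonneg.mpr hb) (sq_nonneg |x|),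
            abs_nonneg x]

lemma gaussS_apply (b : ℝ) (hb : 1 ≤ b) (x : ℝ) : gaussS b hb x = Real.exp (-b * x ^ 2) := rfl

lemma one_le_pi : (1 : ℝ) ≤ Real.pi := by linarith [Real.pi_gt_three]

/-- The test function. -/
noncomputable def testS : SchwartzMap ℝ ℝ :=
  gaussS Real.pi one_le_pi - (3 : ℝ) • gaussS (4 * Real.pi) (by linarith [one_le_pi])
    + (2 : ℝ) • gaussS (16 * Real.pi) (by linarith [one_le_pi])

lemma testS_apply (x : ℝ) : testS x = Real.exp (-Real.pi * x ^ 2)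
    - 3 * Real.exp (-(4 * Real.pi) * x ^ 2) + 2 * Real.exp (-(16 * Real.pi) * x ^ 2) := rfl

lemma testS_mem : testS ∈ S0ev := by
  refine ⟨fun x => by simp [testS_apply], by norm_num [testS_apply], ?_⟩
  simp only [testS_apply]
  have h (b : ℝ) (hb : 0 < b) : Integrable fun x : ℝ => Real.exp (-b * x ^ 2) :=
    integrable_exp_neg_mul_sq hb
  have hp := Real.pi_pos
  have i4 := (h (4 * Real.pi) (by positivity)).const_mul 3
  have i16 := (h (16 * Real.pi) (by positivity)).const_mul 2
  have i1 : Integrable fun x : ℝ => Real.exp (-Real.pi * x ^ 2) -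
    3 * Real.exp (-(4 * Real.pi) * x ^ 2) := (h _ hp).sub i4
  rw [integral_add i1 i16, integral_sub (h _ hp) i4,
    integral_const_mul, integral_const_mul, integral_gaussian, integral_gaussian,
    integral_gaussian, div_self hp.ne']
  have e1 : Real.pi / (4 * Real.pi) = (1 / 2) ^ 2 := by field_simp; norm_num
  have e2 : Real.pi / (16 * Real.pi) = (1 / 4) ^ 2 := by field_simp; norm_num
  rw [e1, e2, Real.sqrt_sq (by norm_num), Real.sqrt_sq (by norm_num), Real.sqrt_one]
  norm_num

/-- Unfolding. -/
lemma unfold_integral {μ : ℝ} (hμ : 1 < μ) {H : ℝ → ℂ} (hH : IntegrableOn H (Ioi 0)) :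
    ∫ u in Ioc (1:ℝ) μ, ∑' k : ℤ, ((μ ^ k : ℝ) : ℂ) * H (μ ^ k * u) = ∫ u in Ioi (0:ℝ), H u := by
  have hpos : 0 < μ := by linarith
  have hU : (⋃ k : ℤ, Ioc (μ ^ k) (μ ^ (k + 1))) = Ioi 0 := by
    ext x
    simp only [mem_iUnion, mem_Ioi]
    constructor
    · rintro ⟨k, hk⟩
      exact (zpow_pos hpos k).trans hk.1
    · intro hx
      exact exists_mem_Ioc_zpow hx hμ
  have hmono : Monotone fun k : ℤ => μ ^ k := zpow_right_mono₀ hμ.le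
  have hd : Pairwise (Function.onFun Disjoint fun k : ℤ => Ioc (μ ^ k) (μ ^ (k + 1))) := by
    have := hmono.pairwise_disjoint_on_Ioc_succ
    simpa [Order.succ_eq_add_one] using this
  have hcv (E : Type) [NormedAddCommGroup E] [NormedSpace ℝ E] (G : ℝ → E) (k : ℤ) :
      ∫ u in Ioc (1:ℝ) μ, (μ ^ k) • G (μ ^ k * u) = ∫ u in Ioc (μ ^ k) (μ ^ (k + 1)), G u := by
    have h := intervalIntegral.smul_integral_comp_mul_left (a := 1) (b := μ) G (μ ^ k)
    rw [mul_one, ← zpow_add_one₀ hpos.ne', intervalIntegral.integral_of_le hμ.le,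
      intervalIntegral.integral_of_le (hmono (by simp)), ← integral_smul] at h
    exact h
  have h1 := hasSum_integral_iUnion (f := H) (μ := volume) (fun k : ℤ => measurableSet_Ioc) hd
    (by rw [hU]; exact hH)
  have h2 := hasSum_integral_iUnion (f := fun u => ‖H u‖) (μ := volume)
    (fun k : ℤ => measurableSet_Ioc) hd (by rw [hU]; exact hH.norm)
  have hint (k : ℤ) : IntegrableOn (fun u => ((μ ^ k : ℝ) : ℂ) * H (μ ^ k * u)) (Ioc 1 μ) := by
    have hk := zpow_pos hpos k
    have := (integrableOn_Ioi_comp_mul_left_iff H 0 hk).mpr (by rwa [mul_zero])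
    exact (this.mono_set (fun x hx => (zero_lt_one.trans hx.1 : (0:ℝ) < x))).const_mul _
  have h3 := hasSum_integral_of_summable_integral_norm
    (F := fun (k : ℤ) u => ((μ ^ k : ℝ) : ℂ) * H (μ ^ k * u)) hint ?_
  · rw [hU] at h1
    refine h3.unique ?_
    convert h1 using 2 with k
    rw [← hcv ℂ H k]
    simp only [Complex.real_smul]
  · refine h2.summable.congr fun k => ?_
    rw [← hcv ℝ (fun u => ‖H u‖) k]
    refine integral_congr_ae (Filter.Eventually.of_forall fun u => ?_)
    simp only [norm_mul, Complex.norm_real, smul_eq_mul, Real.norm_eq_abs]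
    rw [abs_of_pos (zpow_pos hpos k)]

open Filter Topology Asymptotics in
lemma kap_top_aux (a : ℝ) :
    (fun t : ℝ => HurwitzZeta.cosKernel 0 t - 1) =O[atTop] fun t => t ^ (-a) := by
  obtain ⟨p, hp, h⟩ := HurwitzZeta.isBigO_atTop_cosKernel_sub 0
  exact h.trans (isLittleO_exp_neg_mul_rpow_atTop hp _).isBigO

/-- The theta series without constant term. -/
noncomputable def kap (t : ℝ) : ℝ := HurwitzZeta.cosKernel 0 t - 1

open Filter Topology Asymptotics in
lemma kap_top (a : ℝ) {c : ℝ} (hc : 0 < c) :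
    (fun t : ℝ => kap (c * t)) =O[atTop] fun t => t ^ (-a) := by
  have h := (kap_top_aux a).comp_tendsto (tendsto_id.const_mul_atTop hc)
  refine h.trans (IsBigO.of_bound (|c ^ (-a)|) ?_)
  filter_upwards [eventually_gt_atTop 0] with t ht
  simp only [Function.comp, id]
  rw [Real.mul_rpow hc.le ht.le, norm_mul, Real.norm_eq_abs (c ^ (-a))]

open Filter Topology Asymptotics in
lemma kap_bot_inv (a : ℝ) {c : ℝ} (hc : 0 < c) :
    (fun t : ℝ => kap (c * t⁻¹)) =O[𝓝[>] 0] fun t => t ^ a := by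
  have h := (kap_top a hc).comp_tendsto tendsto_inv_nhdsGT_zero
  refine h.trans (IsBigO.of_bound 1 ?_)
  filter_upwards [self_mem_nhdsWithin] with t ht
  simp only [Function.comp]
  rw [Real.inv_rpow (le_of_lt ht), Real.rpow_neg (le_of_lt ht), inv_inv, one_mul]

lemma kap_fe {t : ℝ} (ht : 0 < t) : kap t = t ^ (-(1 / 2) : ℝ) * (kap t⁻¹ + 1) - 1 := by
  unfold kap
  have := HurwitzZeta.evenKernel_functional_equation 0 t
  rw [HurwitzZeta.evenKernel_eq_cosKernel_of_zero] at this
  rw [this, one_div, one_div t, Real.rpow_neg ht.le]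
  ring

lemma kap_cont : ContinuousOn kap (Ioi 0) :=
  (HurwitzZeta.continuousOn_cosKernel 0).sub continuousOn_const

lemma kap_hasSum {t : ℝ} (ht : 0 < t) :
    HasSum (fun n : ℕ => 2 * Real.exp (-Real.pi * ((n : ℝ) + 1) ^ 2 * t)) (kap t) := by
  have := HurwitzZeta.hasSum_nat_cosKernel₀ 0 ht
  simpa [kap] using this

/-- Theta series of the test function. -/
noncomputable def Fth (t : ℝ) : ℝ := (kap t - 3 * kap (4 * t) + 2 * kap (16 * t)) / 2

lemma Fth_hasSum {u : ℝ} (hu : 0 < u) :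
    HasSum (fun n : ℕ => testS (((n : ℝ) + 1) * u)) (Fth (u ^ 2)) := by
  have hu2 : 0 < u ^ 2 := by positivity
  have h1 := kap_hasSum hu2
  have h2 := kap_hasSum (t := 4 * u ^ 2) (by positivity)
  have h3 := kap_hasSum (t := 16 * u ^ 2) (by positivity)
  have h := ((h1.sub (h2.mul_left 3)).add (h3.mul_left 2)).div_const 2
  refine h.congr_fun fun n => ?_
  rw [testS_apply]
  ring_nf

lemma Fth_cont : ContinuousOn Fth (Ioi 0) := by
  have h (c : ℝ) (hc : 0 < c) : ContinuousOn (fun t => kap (c * t)) (Ioi 0) :=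
    kap_cont.comp (by fun_prop) fun t ht => mul_pos hc ht
  unfold Fth
  exact ((kap_cont.sub ((h 4 (by norm_num)).const_mul 3)).add
    ((h 16 (by norm_num)).const_mul 2)).div_const 2

open Filter Topology Asymptotics in
lemma Fth_top (a : ℝ) : (fun t => (Fth t : ℂ)) =O[atTop] fun t => t ^ (-a) := by
  rw [← isBigO_norm_left]
  simp only [Complex.norm_real]
  rw [isBigO_norm_left]
  have h1 := kap_top a one_pos
  simp only [one_mul] at h1
  have h := ((h1.sub ((kap_top a (c := 4) (by norm_num)).const_mul_left 3)).add
    ((kap_top a (c := 16) (by norm_num)).const_mul_left 2)).const_mul_left (1 / 2)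
  refine h.congr_left fun t => ?_
  unfold Fth
  ring

open Filter Topology Asymptotics in
lemma Fth_bot (b : ℝ) : (fun t => (Fth t : ℂ)) =O[𝓝[>] 0] fun t => t ^ (-b) := by
  rw [← isBigO_norm_left]
  simp only [Complex.norm_real]
  rw [isBigO_norm_left]
  have h1 := kap_bot_inv (1 / 2 - b) one_pos
  simp only [one_mul] at h1
  have h := ((h1.sub ((kap_bot_inv (1 / 2 - b) (c := 1 / 4) (by norm_num)).const_mul_left
    (3 / 2))).add ((kap_bot_inv (1 / 2 - b) (c := 1 / 16) (by norm_num)).const_mul_left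
    (1 / 2))).const_mul_left (1 / 2)
  have h' := (isBigO_refl (fun t : ℝ => t ^ (-(1 / 2) : ℝ)) (𝓝[>] 0)).mul h
  refine h'.congr' ?_ ?_
  · filter_upwards [self_mem_nhdsWithin] with t ht
    have ht : 0 < t := ht
    have e4 : (4 : ℝ) ^ (-(1 / 2) : ℝ) = 1 / 2 := by
      rw [Real.rpow_neg (by norm_num), ← Real.sqrt_eq_rpow,
        show (4 : ℝ) = 2 ^ 2 by norm_num, Real.sqrt_sq (by norm_num)]
      norm_num
    have e16 : (16 : ℝ) ^ (-(1 / 2) : ℝ) = 1 / 4 := by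
      rw [Real.rpow_neg (by norm_num), ← Real.sqrt_eq_rpow,
        show (16 : ℝ) = 4 ^ 2 by norm_num, Real.sqrt_sq (by norm_num)]
      norm_num
    unfold Fth
    rw [kap_fe ht, kap_fe (t := 4 * t) (by positivity), kap_fe (t := 16 * t) (by positivity),
      Real.mul_rpow (by norm_num) ht.le, Real.mul_rpow (by norm_num) ht.le, e4, e16, mul_inv,
      mul_inv]
    norm_num
    ring
  · filter_upwards [self_mem_nhdsWithin] with t ht
    rw [← Real.rpow_add ht]
    congr 1
    ring

open Filter Topology Asymptotics in
lemma kap_bot : (fun t => (kap t : ℂ)) =O[𝓝[>] 0] fun t => t ^ (-(1 / 2) : ℝ) := by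
  rw [← isBigO_norm_left]
  simp only [Complex.norm_real]
  rw [isBigO_norm_left]
  have h1 := kap_bot_inv 0 one_pos
  simp only [one_mul, Real.rpow_zero] at h1
  have h2 := h1.add (isBigO_refl (fun _ : ℝ => (1 : ℝ)) (𝓝[>] 0))
  have h3 := (isBigO_refl (fun t : ℝ => t ^ (-(1 / 2) : ℝ)) (𝓝[>] 0)).mul h2
  have h4 : (fun _ : ℝ => (1 : ℝ)) =O[𝓝[>] 0] fun t => t ^ (-(1 / 2) : ℝ) := by
    refine IsBigO.of_bound 1 ?_
    filter_upwards [Ioo_mem_nhdsGT (one_pos : (0 : ℝ) < 1)] with t ht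
    rw [one_mul, norm_one, Real.norm_eq_abs]
    exact (Real.one_le_rpow_of_pos_of_le_one_of_nonpos ht.1 ht.2.le (by norm_num)).trans
      (le_abs_self _)
  simp only [mul_one] at h3
  refine (h3.sub h4).congr' ?_ (EventuallyEq.refl _ _)
  filter_upwards [self_mem_nhdsWithin] with t ht
  exact (kap_fe ht).symm

lemma kap_mellinConvergent {s : ℂ} (hs : 1 / 2 < s.re) :
    MellinConvergent (fun t => (kap t : ℂ)) s := by
  refine mellinConvergent_of_isBigO_rpow (a := s.re + 1) (b := 1 / 2)
    ((Complex.continuous_ofReal.comp_continuousOn kap_cont).locallyIntegrableOn measurableSet_Ioi)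
    ?_ (by linarith) kap_bot hs
  rw [← Asymptotics.isBigO_norm_left]
  simp only [Complex.norm_real]
  rw [Asymptotics.isBigO_norm_left]
  exact kap_top_aux _

lemma Fth_loc : LocallyIntegrableOn (fun t => (Fth t : ℂ)) (Ioi 0) :=
  (Complex.continuous_ofReal.comp_continuousOn Fth_cont).locallyIntegrableOn measurableSet_Ioi

lemma Fth_mellinConvergent (s : ℂ) : MellinConvergent (fun t => (Fth t : ℂ)) s :=
  mellinConvergent_of_isBigO_rpow (a := s.re + 1) (b := s.re - 1) Fth_loc
    (Fth_top _) (by linarith) (Fth_bot _) (by linarith)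

lemma Fth_mellin_diff : Differentiable ℂ (mellin fun t => (Fth t : ℂ)) := fun s =>
  mellin_differentiableAt_of_isBigO_rpow (a := s.re + 1) (b := s.re - 1) Fth_loc
    (Fth_top _) (by linarith) (Fth_bot _) (by linarith)

lemma kap_mellin {z : ℂ} (hz : 1 < z.re) :
    mellin (fun t => (kap t : ℂ)) (z / 2) = 2 * Gammaℝ z * riemannZeta z := by
  have h := hasSum_mellin_pi_mul_sq (ι := ℕ) (a := fun _ => 2) (r := fun n => (n : ℝ) + 1)
    (F := fun t => (kap t : ℂ)) (s := z) (by linarith) ?_ ?_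
  · rw [← h.tsum_eq, zeta_eq_tsum_one_div_nat_add_one_cpow hz, ← tsum_mul_left]
    refine tsum_congr fun n => ?_
    rw [abs_of_pos (by positivity)]
    push_cast
    ring
  · intro t ht
    have := Complex.hasSum_ofReal.mpr (kap_hasSum ht)
    refine this.congr_fun fun n => ?_
    rw [if_neg (by positivity)]
    push_cast
    ring_nf
  · have h1 := (Real.summable_one_div_nat_add_rpow 1 z.re).mpr hz
    refine (h1.mul_left 2).congr fun n => ?_
    simp [div_eq_mul_inv]

lemma four_cpow (z : ℂ) : ((4 : ℝ) : ℂ) ^ (-(z / 2)) = (2 : ℂ) ^ (-z) := by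
  have h := Complex.natCast_mul_natCast_cpow 2 2 (-(z / 2))
  rw [show ((4 : ℝ) : ℂ) = ((2 : ℕ) : ℂ) * ((2 : ℕ) : ℂ) by norm_num, h,
    ← Complex.cpow_add _ _ (by norm_num)]
  norm_num
  ring_nf

lemma sixteen_cpow (z : ℂ) : ((16 : ℝ) : ℂ) ^ (-(z / 2)) = (2 : ℂ) ^ (-z) * (2 : ℂ) ^ (-z) := by
  have h := Complex.natCast_mul_natCast_cpow 4 4 (-(z / 2))
  rw [← four_cpow, show ((16 : ℝ) : ℂ) = ((4 : ℕ) : ℂ) * ((4 : ℕ) : ℂ) by norm_num, h]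
  norm_num

lemma Fth_mellin_of_one_lt {z : ℂ} (hz : 1 < z.re) :
    mellin (fun t => (Fth t : ℂ)) (z / 2) =
      (1 - (2 : ℂ) ^ (-z)) * (1 - 2 * (2 : ℂ) ^ (-z)) * Gammaℝ z * riemannZeta z := by
  have hz2 : 1 / 2 < (z / 2).re := by rw [Complex.div_ofNat_re]; linarith
  have c1 := kap_mellinConvergent hz2
  have c4 := (MellinConvergent.comp_mul_left (a := 4) (by norm_num)).mpr c1
  have c16 := (MellinConvergent.comp_mul_left (a := 16) (by norm_num)).mpr c1
  have m4 := hasMellin_const_smul c4 (3 : ℂ)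
  have m16 := hasMellin_const_smul c16 (2 : ℂ)
  have s1 := hasMellin_sub c1 m4.1
  have s2 := hasMellin_add s1.1 m16.1
  have s3 := mellin_div_const (fun t => ((kap t : ℂ) - (3 : ℂ) • (kap (4 * t) : ℂ)) +
    (2 : ℂ) • (kap (16 * t) : ℂ)) (z / 2) 2
  have e : (fun t => (Fth t : ℂ)) = fun t => (((kap t : ℂ) - (3 : ℂ) • (kap (4 * t) : ℂ)) +
    (2 : ℂ) • (kap (16 * t) : ℂ)) / 2 := by
    funext t
    simp [Fth]
  have k4 := mellin_comp_mul_left (fun t => (kap t : ℂ)) (z / 2) (a := 4) (by norm_num)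
  have k16 := mellin_comp_mul_left (fun t => (kap t : ℂ)) (z / 2) (a := 16) (by norm_num)
  rw [e, s3, s2.2, s1.2, m4.2, m16.2, k4, k16, kap_mellin hz, four_cpow, sixteen_cpow]
  simp only [smul_eq_mul]
  ring

lemma Fth_mellin {z : ℂ} (hz : z ≠ 1) :
    (Gammaℝ z)⁻¹ * mellin (fun t => (Fth t : ℂ)) (z / 2) =
      (1 - (2 : ℂ) ^ (-z)) * (1 - 2 * (2 : ℂ) ^ (-z)) * riemannZeta z := by
  have hL : AnalyticOnNhd ℂ (fun z => (Gammaℝ z)⁻¹ * mellin (fun t => (Fth t : ℂ)) (z / 2))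
      {1}ᶜ := by
    refine DifferentiableOn.analyticOnNhd (fun z _ => ?_) isOpen_compl_singleton
    exact (differentiable_Gammaℝ_inv.differentiableAt.mul
      (Fth_mellin_diff.differentiableAt.comp z
        (by fun_prop : DifferentiableAt ℂ (fun z : ℂ => z / 2) z))).differentiableWithinAt
  have hR : AnalyticOnNhd ℂ
      (fun z => (1 - (2 : ℂ) ^ (-z)) * (1 - 2 * (2 : ℂ) ^ (-z)) * riemannZeta z) {1}ᶜ := by
    refine DifferentiableOn.analyticOnNhd (fun z hz => ?_) isOpen_compl_singleton
    have h2 : DifferentiableAt ℂ (fun z : ℂ => (2 : ℂ) ^ (-z)) z :=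
      DifferentiableAt.const_cpow (by fun_prop) (Or.inl (by norm_num))
    exact (((h2.const_sub 1).mul ((h2.const_mul 2).const_sub 1)).mul
      (differentiableAt_riemannZeta hz)).differentiableWithinAt
  refine hL.eqOn_of_preconnected_of_eventuallyEq hR
    (isConnected_compl_singleton_of_one_lt_rank (by simp) 1).isPreconnected
    (z₀ := 2) (by simp) ?_ hz
  have : {z : ℂ | 1 < z.re} ∈ nhds (2 : ℂ) :=
    (isOpen_lt continuous_const Complex.continuous_re).mem_nhds (by simp)
  filter_upwards [this] with w hw
  have hw : 1 < w.re := hw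
  have hG := Gammaℝ_ne_zero_of_re_pos (s := w) (by linarith)
  rw [Fth_mellin_of_one_lt hw]
  field_simp

/-- if the character `χ(u) = u^{is}` (with `μ^{is} = 1`) occurs in the spectrum
of the rotation action on the orthogonal complement of `Σ_μ E(S₀^ev)` in `L²(ℝ₊*/μ^ℤ)` —
equivalently, `χ` is orthogonal to all `Σ_μ E(f)`, `f ∈ S₀^ev` — then `ζ(1/2+is) = 0`. -/
theorem stmt8 (μ s : ℝ) (hμ : 1 < μ) (hchar : (μ : ℂ) ^ (Complex.I * (s : ℂ)) = 1)
    (horth : ∀ f ∈ S0ev,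
      (∫ u in Set.Ioc (1:ℝ) μ,
        (u : ℂ) ^ (Complex.I * (s : ℂ)) * (SigmaE μ f u : ℂ) / (u : ℂ)) = 0) :
    riemannZeta (1 / 2 + Complex.I * s) = 0 := by
  have hpos : 0 < μ := by linarith
  set z : ℂ := 1 / 2 + Complex.I * s with hzdef
  have hzre : z.re = 1 / 2 := by simp [hzdef]
  have hz1 : z ≠ 1 := by
    intro h
    rw [h] at hzre
    norm_num at hzre
  have h0 := horth testS testS_mem
  -- the Mellin integrand
  set H : ℝ → ℂ := fun u => (u : ℂ) ^ (z - 1) • (Fth (u ^ (2 : ℝ)) : ℂ) with hH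
  have hconv : MellinConvergent (fun u => (Fth (u ^ (2 : ℝ)) : ℂ)) z :=
    (MellinConvergent.comp_rpow (f := fun t => (Fth t : ℂ)) two_ne_zero).mpr
      (Fth_mellinConvergent _)
  have hmel := mellin_comp_rpow (fun t => (Fth t : ℂ)) z 2
  have hunf := unfold_integral hμ (H := H) hconv
  have hk (k : ℤ) : ((μ ^ k : ℝ) : ℂ) ^ (Complex.I * (s : ℂ)) = 1 := by
    have hm : (μ : ℂ) ≠ 0 := Complex.ofReal_ne_zero.mpr hpos.ne'
    have hmk : ((μ ^ k : ℝ) : ℂ) ≠ 0 := Complex.ofReal_ne_zero.mpr (zpow_pos hpos k).ne'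
    rw [Complex.cpow_def_of_ne_zero hm, ← Complex.ofReal_log hpos.le] at hchar
    rw [Complex.cpow_def_of_ne_zero hmk, ← Complex.ofReal_log (zpow_pos hpos k).le, Real.log_zpow,
      Complex.ofReal_mul, Complex.ofReal_intCast, mul_assoc, Complex.exp_int_mul, hchar, one_zpow]
  have heq : ∫ u in Ioc (1:ℝ) μ, ∑' k : ℤ, ((μ ^ k : ℝ) : ℂ) * H (μ ^ k * u) = 0 := by
    rw [← h0]
    refine setIntegral_congr_fun measurableSet_Ioc fun u hu => ?_
    have hu0 : 0 < u := by linarith [hu.1]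
    simp only [SigmaE]
    rw [Complex.ofReal_tsum, ← tsum_mul_left, ← tsum_div_const]
    refine tsum_congr fun k => ?_
    have hx : 0 < μ ^ k * u := mul_pos (zpow_pos hpos k) hu0
    rw [(Fth_hasSum hx).tsum_eq]
    have hx' : ((μ ^ k * u : ℝ) : ℂ) ≠ 0 := Complex.ofReal_ne_zero.mpr hx.ne'
    have hu' : (u : ℂ) ≠ 0 := Complex.ofReal_ne_zero.mpr hu0.ne'
    have hm' : ((μ ^ k : ℝ) : ℂ) ≠ 0 := Complex.ofReal_ne_zero.mpr (zpow_pos hpos k).ne'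
    have e1 : ((μ ^ k * u : ℝ) : ℂ) ^ (Complex.I * (s : ℂ)) = (u : ℂ) ^ (Complex.I * (s : ℂ)) := by
      rw [Complex.ofReal_mul, Complex.mul_cpow_ofReal_nonneg (zpow_pos hpos k).le hu0.le, hk,
        one_mul]
    have e2 : ((Real.sqrt (μ ^ k * u) : ℝ) : ℂ) = ((μ ^ k * u : ℝ) : ℂ) ^ (1 / 2 : ℂ) := by
      rw [Real.sqrt_eq_rpow, Complex.ofReal_cpow hx.le]
      norm_num
    have e3 : ((μ ^ k * u : ℝ) : ℂ) ^ (z - 1) = (Real.sqrt (μ ^ k * u) : ℂ) *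
        (u : ℂ) ^ (Complex.I * (s : ℂ)) / ((μ ^ k * u : ℝ) : ℂ) := by
      rw [Complex.cpow_sub _ _ hx', hzdef, Complex.cpow_add _ _ hx', Complex.cpow_one, e1, e2]
    simp only [hH]
    rw [e3, Real.rpow_two, smul_eq_mul, Complex.ofReal_mul (μ ^ k) u, Complex.ofReal_mul]
    field_simp
  have hM : mellin (fun t => (Fth t : ℂ)) (z / 2) = 0 := by
    have h1 : mellin (fun u => (Fth (u ^ (2 : ℝ)) : ℂ)) z = 0 := hunf.symm.trans heq
    rw [hmel] at h1
    have h2 := (smul_eq_zero.mp h1).resolve_left (by norm_num)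
    simpa using h2
  have hF := Fth_mellin hz1
  rw [hM, mul_zero] at hF
  have hn : ‖(2 : ℂ) ^ (-z)‖ = (2 : ℝ) ^ (-(1 / 2) : ℝ) := by
    have := Complex.norm_cpow_eq_rpow_re_of_pos (x := 2) (by norm_num) (-z)
    rw [Complex.neg_re, hzre] at this
    exact_mod_cast this
  have hsq : ((2 : ℝ) ^ (-(1 / 2) : ℝ)) ^ 2 = 1 / 2 := by
    rw [← Real.rpow_natCast, ← Real.rpow_mul (by norm_num)]
    norm_num
  have hA : (1 - (2 : ℂ) ^ (-z)) ≠ 0 := by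
    intro h
    rw [← sub_eq_zero.mp h, norm_one] at hn
    rw [← hn] at hsq
    norm_num at hsq
  have hB : (1 - 2 * (2 : ℂ) ^ (-z)) ≠ 0 := by
    intro h
    have h' : (2 : ℂ) ^ (-z) = 1 / 2 := by
      rw [eq_div_iff two_ne_zero, mul_comm]
      exact (sub_eq_zero.mp h).symm
    rw [h'] at hn
    rw [← hn] at hsq
    norm_num at hsq
  exact (mul_eq_zero.mp hF.symm).resolve_left (mul_ne_zero hA hB)
end

section
/- Define H(L) = (Σ_μE(S₀^ev))^⊥ ⊂ L²(ℝ₊*/μ^ℤ) with μ = e^L. Then H(L) ≠ {0} if and only if there exist s in the set Z of imaginary parts of critical zeros of ζ and n ∈ ℤ such that sL = 2πn. -/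
open MeasureTheory Set Complex

section
open MeasureTheory Set Complex
open scoped FourierTransform SchwartzMap

lemma zc_decay {F : Type*} [NormedAddCommGroup F] [NormedSpace ℝ F] (f : SchwartzMap ℝ F) (k : ℕ) :
    ∃ C : ℝ, 0 ≤ C ∧ ∀ x : ℝ, |x| ^ k * ‖f x‖ ≤ C := by
  obtain ⟨C, hC0, hC⟩ := f.decay k 0
  refine ⟨C, hC0.le, ?_⟩
  intro x
  simpa using hC x

lemma zc_summable_sq : Summable fun n : ℕ => (((n : ℝ) + 1) ^ 2)⁻¹ := by
  have h : Summable fun n : ℕ => (((n : ℝ)) ^ 2)⁻¹ := by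
    simp
  simpa using (summable_nat_add_iff 1).2 h

lemma zc_sum_bound {E : Type*} [NormedAddCommGroup E] [CompleteSpace E] (h : ℝ → E) (C : ℝ)
    (hh : ∀ x : ℝ, |x| ^ 2 * ‖h x‖ ≤ C) (u : ℝ) (hu : 0 < u) (n : ℕ) :
    ‖h (((n : ℝ) + 1) * u)‖ ≤ (C * (u ^ 2)⁻¹) * (((n : ℝ) + 1) ^ 2)⁻¹ := by
  have h1 := hh (((n : ℝ) + 1) * u)
  rw [abs_of_pos (by positivity)] at h1
  rw [mul_assoc, ← mul_inv, ← div_eq_mul_inv, le_div_iff₀ (by positivity)]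
  calc _ = _ := ?_
    _ ≤ C := h1
  ring

lemma zc_summable {E : Type*} [NormedAddCommGroup E] [CompleteSpace E] (h : ℝ → E) (C : ℝ)
    (hh : ∀ x : ℝ, |x| ^ 2 * ‖h x‖ ≤ C) (u : ℝ) (hu : 0 < u) :
    Summable fun n : ℕ => h (((n : ℝ) + 1) * u) :=
  Summable.of_norm_bounded (zc_summable_sq.mul_left _) (zc_sum_bound h C hh u hu)

lemma zc_tsum_bound {E : Type*} [NormedAddCommGroup E] [CompleteSpace E] (h : ℝ → E) (C : ℝ)
    (hh : ∀ x : ℝ, |x| ^ 2 * ‖h x‖ ≤ C) (u : ℝ) (hu : 0 < u) :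
    ‖∑' n : ℕ, h (((n : ℝ) + 1) * u)‖ ≤ (C * ∑' n : ℕ, (((n : ℝ) + 1) ^ 2)⁻¹) * (u ^ 2)⁻¹ := by
  refine (tsum_of_norm_bounded (zc_summable_sq.mul_left (C * (u ^ 2)⁻¹)).hasSum
    (zc_sum_bound h C hh u hu)).trans (le_of_eq ?_)
  rw [tsum_mul_left]; ring

/-- scaling of Schwartz functions -/
noncomputable def zcScale {F : Type*} [NormedAddCommGroup F] [NormedSpace ℝ F] (a : ℝˣ)
    (f : SchwartzMap ℝ F) : SchwartzMap ℝ F :=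
  SchwartzMap.compCLMOfContinuousLinearEquiv ℝ (ContinuousLinearEquiv.unitsEquivAut ℝ a) f

lemma zcScale_apply {F : Type*} [NormedAddCommGroup F] [NormedSpace ℝ F] (a : ℝˣ)
    (f : SchwartzMap ℝ F) (x : ℝ) : zcScale a f x = f (x * a) := by
  simp [zcScale]

/-- complexification -/
noncomputable def zcC (f : SchwartzMap ℝ ℝ) : SchwartzMap ℝ ℂ :=
  SchwartzMap.postcompCLM Complex.ofRealCLM f

lemma zcC_apply (f : SchwartzMap ℝ ℝ) (x : ℝ) : zcC f x = (f x : ℂ) := by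
  simp [zcC]

lemma zc_fourier_scale (f : SchwartzMap ℝ ℂ) (a : ℝˣ) (ha : 0 < (a : ℝ)) (w : ℝ) :
    𝓕 (zcScale a f) w = (a : ℝ)⁻¹ • 𝓕 f (w * (a : ℝ)⁻¹) := by
  rw [SchwartzMap.fourier_coe, SchwartzMap.fourier_coe, Real.fourier_real_eq_integral_exp_smul,
    Real.fourier_real_eq_integral_exp_smul]
  have := Measure.integral_comp_mul_right (fun v : ℝ => Complex.exp (↑(-2 * Real.pi * v * (w * (a : ℝ)⁻¹)) * Complex.I) • f v) (a : ℝ)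
  rw [abs_of_pos (inv_pos.2 ha)] at this
  rw [← this]
  congr 1
  ext v
  rw [zcScale_apply]
  congr 4
  field_simp

lemma zc_fourier_even (f : SchwartzMap ℝ ℂ) (hf : ∀ x, f (-x) = f x) (w : ℝ) :
    𝓕 f (-w) = 𝓕 f w := by
  rw [SchwartzMap.fourier_coe, Real.fourier_real_eq_integral_exp_smul,
    Real.fourier_real_eq_integral_exp_smul, ← integral_neg_eq_self]
  congr 1
  ext v
  rw [hf]
  congr 4
  ring

lemma zc_fourier_zero (f : SchwartzMap ℝ ℂ) : 𝓕 f 0 = ∫ x, f x := by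
  rw [SchwartzMap.fourier_coe, Real.fourier_real_eq_integral_exp_smul]
  simp

lemma zc_int_sum (h : ℝ → ℂ) (C : ℝ) (hh : ∀ x : ℝ, |x| ^ 2 * ‖h x‖ ≤ C) (h0 : h 0 = 0)
    (he : ∀ x, h (-x) = h x) : ∑' n : ℤ, h n = 2 * ∑' n : ℕ, h ((n : ℝ) + 1) := by
  have hs : Summable fun n : ℕ => h ((n : ℝ) + 1) := by
    simpa using zc_summable h C hh 1 one_pos
  have hs' : HasSum (fun n : ℕ => h ((n : ℤ) : ℝ)) (∑' n : ℕ, h ((n : ℝ) + 1)) := by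
    rw [← hasSum_nat_add_iff' 1]
    simpa [h0] using hs.hasSum
  have := HasSum.of_nat_of_neg_add_one (f := fun n : ℤ => h n) (m' := ∑' n : ℕ, h ((n : ℝ) + 1))
    hs' (by
      have h2 : ∀ n : ℕ, h ((-((n : ℤ) + 1) : ℤ) : ℝ) = h ((n : ℝ) + 1) := by
        intro n; push_cast; rw [← he]; ring_nf
      simp only [h2]; exact hs.hasSum)
  rw [this.tsum_eq]; ring

lemma zc_poisson (f : SchwartzMap ℝ ℂ) (he : ∀ x, f (-x) = f x) (h0 : f 0 = 0)
    (hi : ∫ x, f x = 0) (u : ℝ) (hu : 0 < u) :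
    ∑' n : ℕ, f (((n : ℝ) + 1) * u) = (u⁻¹ : ℝ) • ∑' n : ℕ, 𝓕 f (((n : ℝ) + 1) * u⁻¹) := by
  obtain ⟨a, ha⟩ : ∃ a : ℝˣ, (a : ℝ) = u := ⟨Units.mk0 u hu.ne', rfl⟩
  have hp := SchwartzMap.tsum_eq_tsum_fourier (zcScale a f) 0
  simp only [zero_add, QuotientAddGroup.mk_zero, fourier_eval_zero, mul_one] at hp
  obtain ⟨C, -, hC⟩ := zc_decay (zcScale a f) 2
  obtain ⟨D, -, hD⟩ := zc_decay (𝓕 (zcScale a f)) 2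
  rw [zc_int_sum _ C hC (by simp [zcScale_apply, h0]) (by simp [zcScale_apply, he]),
    zc_int_sum _ D hD] at hp
  · have hp' := mul_left_cancel₀ two_ne_zero hp
    simp only [zcScale_apply, zc_fourier_scale f a (ha ▸ hu), ha] at hp'
    rw [hp', tsum_const_smul'']
  · rw [zc_fourier_scale f a (ha ▸ hu)]
    simp [zc_fourier_zero, hi]
  · exact zc_fourier_even _ (by simp [zcScale_apply, he])

/-- `F(u) = ∑_{n ≥ 1} f(nu)` -/
noncomputable def zcF (f : SchwartzMap ℝ ℝ) (u : ℝ) : ℝ := ∑' n : ℕ, f (((n : ℝ) + 1) * u)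

lemma zcF_ofReal (f : SchwartzMap ℝ ℝ) (u : ℝ) :
    ((zcF f u : ℝ) : ℂ) = ∑' n : ℕ, zcC f (((n : ℝ) + 1) * u) := by
  simp [zcF, zcC_apply, Complex.ofReal_tsum]

lemma zcF_bound_top (f : SchwartzMap ℝ ℝ) : ∃ C : ℝ, 0 ≤ C ∧ ∀ u : ℝ, 0 < u →
    |zcF f u| ≤ C * (u ^ 2)⁻¹ := by
  obtain ⟨C, hC0, hC⟩ := zc_decay f 2
  refine ⟨C * ∑' n : ℕ, (((n : ℝ) + 1) ^ 2)⁻¹, by positivity, fun u hu => ?_⟩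
  exact zc_tsum_bound f C hC u hu

lemma zcF_bound_zero (f : SchwartzMap ℝ ℝ) (hf : f ∈ S0ev) : ∃ C : ℝ, 0 ≤ C ∧ ∀ u : ℝ, 0 < u →
    |zcF f u| ≤ C * u := by
  obtain ⟨he, h0, hi⟩ := hf
  obtain ⟨C, hC0, hC⟩ := zc_decay (𝓕 (zcC f)) 2
  refine ⟨C * ∑' n : ℕ, (((n : ℝ) + 1) ^ 2)⁻¹, by positivity, fun u hu => ?_⟩
  have h1 := zc_poisson (zcC f) (by simp [zcC_apply, he]) (by simp [zcC_apply, h0])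
    (by simp only [zcC_apply]; rw [integral_complex_ofReal, hi]; simp) u hu
  have h2 := zc_tsum_bound (𝓕 (zcC f) : SchwartzMap ℝ ℂ) C hC u⁻¹ (by positivity)
  rw [← zcF_ofReal] at h1
  rw [← Real.norm_eq_abs, ← Complex.norm_real, h1, norm_smul, Real.norm_of_nonneg (by positivity)]
  calc _ ≤ u⁻¹ * _ := mul_le_mul_of_nonneg_left h2 (by positivity)
    _ = _ := by field_simp

lemma zcF_cont (f : SchwartzMap ℝ ℝ) : ContinuousOn (zcF f) (Ioi 0) := by
  obtain ⟨C, hC0, hC⟩ := zc_decay f 2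
  have key : ∀ a : ℝ, 0 < a → ContinuousOn (zcF f) (Ioi a) := by
    intro a ha
    refine continuousOn_tsum (u := fun n : ℕ => (C * (a ^ 2)⁻¹) * (((n : ℝ) + 1) ^ 2)⁻¹) ?_
      (zc_summable_sq.mul_left _) ?_
    · intro n
      exact (f.continuous.comp (by fun_prop)).continuousOn
    · intro n x hx
      have hx' : a < x := hx
      refine (zc_sum_bound f C hC x (ha.trans hx) n).trans ?_
      gcongr
  intro x hx
  have hx' : 0 < x := hx
  exact ((key (x / 2) (by positivity)).continuousAt (Ioi_mem_nhds (by linarith))).continuousWithinAt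

open MeasureTheory Set Complex
open scoped FourierTransform SchwartzMap Topology

lemma zc_loc (h : ℝ → ℂ) (hc : ContinuousOn h (Ioi 0)) : LocallyIntegrableOn h (Ioi 0) :=
  hc.locallyIntegrableOn measurableSet_Ioi

lemma zcF_contC (f : SchwartzMap ℝ ℝ) : ContinuousOn (fun u => (zcF f u : ℂ)) (Ioi 0) :=
  Complex.continuous_ofReal.comp_continuousOn (zcF_cont f)

lemma zcF_O_top (f : SchwartzMap ℝ ℝ) :
    (fun u => (zcF f u : ℂ)) =O[Filter.atTop] (fun u : ℝ => u ^ (-2 : ℝ)) := by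
  obtain ⟨C, hC0, hC⟩ := zcF_bound_top f
  refine Asymptotics.IsBigO.of_bound C ?_
  filter_upwards [Filter.eventually_gt_atTop 0] with u hu
  rw [Complex.norm_real, Real.norm_eq_abs, Real.norm_of_nonneg (by positivity), Real.rpow_neg hu.le]
  simpa using hC u hu

lemma zcF_O_zero (f : SchwartzMap ℝ ℝ) (hf : f ∈ S0ev) :
    (fun u => (zcF f u : ℂ)) =O[𝓝[>] 0] (fun u : ℝ => u ^ (-(-1) : ℝ)) := by
  obtain ⟨C, hC0, hC⟩ := zcF_bound_zero f hf
  refine Asymptotics.IsBigO.of_bound C ?_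
  filter_upwards [self_mem_nhdsWithin] with u hu
  have hu' : 0 < u := hu
  rw [Complex.norm_real, Real.norm_eq_abs, Real.norm_of_nonneg (by positivity)]
  simpa using hC u hu

lemma zcf_O_top (f : SchwartzMap ℝ ℝ) :
    (fun u => (f u : ℂ)) =O[Filter.atTop] (fun u : ℝ => u ^ (-2 : ℝ)) := by
  obtain ⟨C, hC0, hC⟩ := zc_decay f 2
  refine Asymptotics.IsBigO.of_bound C ?_
  filter_upwards [Filter.eventually_gt_atTop 0] with u hu
  rw [Complex.norm_real, Real.norm_eq_abs, Real.norm_of_nonneg (by positivity), Real.rpow_neg hu.le]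
  have := hC u
  rw [abs_of_pos hu, Real.norm_eq_abs] at this
  rw [← div_eq_mul_inv, le_div_iff₀ (by positivity)]
  simpa [mul_comm] using this

lemma zcf_O_zero (f : SchwartzMap ℝ ℝ) :
    (fun u => (f u : ℂ)) =O[𝓝[>] 0] (fun u : ℝ => u ^ (-0 : ℝ)) := by
  obtain ⟨C, hC0, hC⟩ := zc_decay f 0
  refine Asymptotics.IsBigO.of_bound C ?_
  filter_upwards [self_mem_nhdsWithin] with u hu
  simpa using hC u

lemma zcf_contC (f : SchwartzMap ℝ ℝ) : ContinuousOn (fun u => (f u : ℂ)) (Ioi 0) :=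
  (Complex.continuous_ofReal.comp f.continuous).continuousOn

lemma zcF_diff (f : SchwartzMap ℝ ℝ) (hf : f ∈ S0ev) (z : ℂ) (h0 : 0 < z.re) (h2 : z.re < 2) :
    DifferentiableAt ℂ (mellin fun u => (zcF f u : ℂ)) z :=
  mellin_differentiableAt_of_isBigO_rpow (zc_loc _ (zcF_contC f)) (zcF_O_top f) h2
    (zcF_O_zero f hf) (by linarith)

lemma zcf_diff (f : SchwartzMap ℝ ℝ) (z : ℂ) (h0 : 0 < z.re) (h2 : z.re < 2) :
    DifferentiableAt ℂ (mellin fun u => (f u : ℂ)) z :=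
  mellin_differentiableAt_of_isBigO_rpow (zc_loc _ (zcf_contC f)) (zcf_O_top f) h2
    (zcf_O_zero f) (by linarith)

lemma zcf_conv (f : SchwartzMap ℝ ℝ) (z : ℂ) (h0 : 0 < z.re) (h2 : z.re < 2) :
    MellinConvergent (fun u => (f u : ℂ)) z :=
  mellinConvergent_of_isBigO_rpow (zc_loc _ (zcf_contC f)) (zcf_O_top f) h2
    (zcf_O_zero f) (by linarith)

lemma zc_mellin_right (f : SchwartzMap ℝ ℝ) (z : ℂ) (h1 : 1 < z.re) (h2 : z.re < 2) :
    mellin (fun u => (zcF f u : ℂ)) z = riemannZeta z * mellin (fun u => (f u : ℂ)) z := by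
  have hconv : ∀ n : ℕ, MellinConvergent (fun u => (f (((n : ℝ) + 1) * u) : ℂ)) z := fun n =>
    (MellinConvergent.comp_mul_left (f := fun u => (f u : ℂ)) (by positivity)).2
      (zcf_conv f z (by linarith) h2)
  have hval : ∀ n : ℕ, mellin (fun u => (f (((n : ℝ) + 1) * u) : ℂ)) z =
      1 / ((n : ℂ) + 1) ^ z * mellin (fun u => (f u : ℂ)) z := by
    intro n
    have := mellin_comp_mul_left (fun u => (f u : ℂ)) z (a := (n : ℝ) + 1) (by positivity)
    rw [this, smul_eq_mul, Complex.cpow_neg, one_div]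
    push_cast
    rfl
  have hnorm : ∀ n : ℕ, ∫ t in Ioi (0 : ℝ), ‖(t : ℂ) ^ (z - 1) • (f (((n : ℝ) + 1) * t) : ℂ)‖ =
      ((n : ℝ) + 1) ^ (-z.re) * ∫ t in Ioi (0 : ℝ), t ^ (z.re - 1) * ‖f t‖ := by
    intro n
    have hn : (0 : ℝ) < (n : ℝ) + 1 := by positivity
    have := integral_comp_mul_left_Ioi (fun t => t ^ (z.re - 1) * ‖f t‖) 0 hn
    rw [mul_zero] at this
    have h3 : ∫ t in Ioi (0 : ℝ), t ^ (z.re - 1) * ‖f t‖ =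
      ((n : ℝ) + 1) * ∫ t in Ioi (0 : ℝ), (((n : ℝ) + 1) * t) ^ (z.re - 1) * ‖f (((n : ℝ) + 1) * t)‖ := by
      rw [this, smul_eq_mul, ← mul_assoc, mul_inv_cancel₀ hn.ne', one_mul]
    rw [h3, ← integral_const_mul, ← integral_const_mul]
    refine setIntegral_congr_fun measurableSet_Ioi fun t ht => ?_
    have ht' : 0 < t := ht
    rw [norm_smul, Complex.norm_cpow_eq_rpow_re_of_pos ht', Complex.norm_real,
      Real.mul_rpow hn.le ht'.le, Real.rpow_sub_one hn.ne', Real.rpow_neg hn.le]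
    have : ((n : ℝ) + 1) ^ z.re ≠ 0 := by positivity
    simp only [sub_re, one_re]
    field_simp
  have key := hasSum_integral_of_summable_integral_norm (μ := volume.restrict (Ioi (0 : ℝ)))
    (F := fun (n : ℕ) (t : ℝ) => (t : ℂ) ^ (z - 1) • (f (((n : ℝ) + 1) * t) : ℂ))
    (fun n => hconv n) (by
      simp only [hnorm]
      refine Summable.mul_right _ ?_
      have := (summable_nat_add_iff 1).2 (Real.summable_nat_rpow.2 (by linarith : -z.re < -1))
      simpa using this)
  have e1 : ∫ t in Ioi (0 : ℝ), ∑' n : ℕ, (t : ℂ) ^ (z - 1) • (f (((n : ℝ) + 1) * t) : ℂ) =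
      mellin (fun u => (zcF f u : ℂ)) z := by
    unfold mellin
    congr 1
    ext t
    rw [tsum_const_smul'']
    congr 1
    exact (Complex.ofReal_tsum _).symm
  rw [e1] at key
  rw [← key.tsum_eq, zeta_eq_tsum_one_div_nat_add_one_cpow h1, ← tsum_mul_right]
  exact tsum_congr hval

lemma zc_mellin (f : SchwartzMap ℝ ℝ) (hf : f ∈ S0ev) (z : ℂ) (h0 : 0 < z.re) (h2 : z.re < 2)
    (hz1 : z ≠ 1) :
    mellin (fun u => (zcF f u : ℂ)) z = riemannZeta z * mellin (fun u => (f u : ℂ)) z := by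
  set U : Set ℂ := {w | 0 < w.re ∧ w.re < 2} with hU
  have hUo : IsOpen U := (isOpen_lt continuous_const continuous_re).inter
    (isOpen_lt continuous_re continuous_const)
  have hUc : IsPreconnected U :=
    ((convex_halfSpace_re_gt 0).inter (convex_halfSpace_re_lt 2)).isPreconnected
  set A : ℂ → ℂ := fun w => w * (w - 1) * mellin (fun u => (zcF f u : ℂ)) w with hA
  set B : ℂ → ℂ := fun w => (w * (w - 1) * completedRiemannZeta₀ w - (w - 1) + w) *
    (Gammaℝ w)⁻¹ * mellin (fun u => (f u : ℂ)) w with hB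
  have hBz : ∀ w : ℂ, w ≠ 0 → w ≠ 1 →
      B w = w * (w - 1) * (riemannZeta w * mellin (fun u => (f u : ℂ)) w) := by
    intro w hw0 hw1
    have h1 : 1 - w ≠ 0 := sub_ne_zero.2 (Ne.symm hw1)
    simp only [hB]
    rw [riemannZeta_def_of_ne_zero hw0, completedRiemannZeta_eq, div_eq_mul_inv _ (Gammaℝ w)]
    field_simp
    ring
  have hAd : AnalyticOnNhd ℂ A U := by
    refine DifferentiableOn.analyticOnNhd (fun w hw => ?_) hUo
    refine DifferentiableAt.differentiableWithinAt ?_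
    exact (by fun_prop : DifferentiableAt ℂ (fun w : ℂ => w * (w - 1)) w).mul
      (zcF_diff f hf w hw.1 hw.2)
  have hBd : AnalyticOnNhd ℂ B U := by
    refine DifferentiableOn.analyticOnNhd (fun w hw => ?_) hUo
    refine DifferentiableAt.differentiableWithinAt ?_
    have h1 : DifferentiableAt ℂ completedRiemannZeta₀ w := differentiable_completedZeta₀ w
    have h2 : DifferentiableAt ℂ (fun w => (Gammaℝ w)⁻¹) w := differentiable_Gammaℝ_inv w
    refine (DifferentiableAt.mul ?_ h2).mul (zcf_diff f w hw.1 hw.2)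
    fun_prop
  have hev : A =ᶠ[𝓝 (3 / 2 : ℂ)] B := by
    have hV : IsOpen {w : ℂ | 1 < w.re ∧ w.re < 2} :=
      (isOpen_lt continuous_const continuous_re).inter (isOpen_lt continuous_re continuous_const)
    filter_upwards [hV.mem_nhds (show (3 / 2 : ℂ) ∈ _ by constructor <;> norm_num)] with w hw
    have hw0 : w ≠ 0 := by rintro rfl; have := hw.1; norm_num at this
    have hw1 : w ≠ 1 := by rintro rfl; have := hw.1; norm_num at this
    rw [hBz w hw0 hw1, hA]
    simp only
    rw [zc_mellin_right f w hw.1 hw.2]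
  have := hAd.eqOn_of_preconnected_of_eventuallyEq hBd hUc
    (show (3 / 2 : ℂ) ∈ U by constructor <;> norm_num) hev (show z ∈ U from ⟨h0, h2⟩)
  have hz0 : z ≠ 0 := by rintro rfl; norm_num at h0
  rw [hBz z hz0 hz1] at this
  exact mul_left_cancel₀ (mul_ne_zero hz0 (sub_ne_zero.2 hz1)) this

open MeasureTheory Set Complex
open scoped FourierTransform SchwartzMap Topology

/-- `G(x) = e^{x/2} F(e^x)` -/
noncomputable def zcG (f : SchwartzMap ℝ ℝ) (x : ℝ) : ℝ := Real.exp (x / 2) * zcF f (Real.exp x)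

/-- the periodization of `G` -/
noncomputable def zcP (L : ℝ) (f : SchwartzMap ℝ ℝ) (x : ℝ) : ℝ := ∑' k : ℤ, zcG f (x + k * L)

lemma zc_SigmaE (L : ℝ) (f : SchwartzMap ℝ ℝ) (x : ℝ) :
    SigmaE (Real.exp L) f (Real.exp x) = zcP L f x := by
  unfold SigmaE zcP zcG zcF
  refine tsum_congr fun k => ?_
  have : Real.exp L ^ k * Real.exp x = Real.exp (x + k * L) := by
    rw [← Real.rpow_intCast, ← Real.exp_mul, ← Real.exp_add, add_comm, mul_comm L]
  rw [this, ← Real.exp_half]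

lemma zcG_cont (f : SchwartzMap ℝ ℝ) : Continuous (zcG f) := by
  unfold zcG
  refine Continuous.mul (by fun_prop) ?_
  exact (zcF_cont f).comp_continuous Real.continuous_exp fun x => Real.exp_pos x

lemma zcG_bound (f : SchwartzMap ℝ ℝ) (hf : f ∈ S0ev) :
    ∃ C : ℝ, 0 ≤ C ∧ ∀ x, |zcG f x| ≤ C * Real.exp (-|x|) := by
  obtain ⟨C, hC0, hC⟩ := zcF_bound_top f
  obtain ⟨D, hD0, hD⟩ := zcF_bound_zero f hf
  refine ⟨C + D, by positivity, fun x => ?_⟩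
  unfold zcG
  rw [abs_mul, abs_of_pos (Real.exp_pos _)]
  rcases le_total 0 x with hx | hx
  · calc _ ≤ Real.exp (x / 2) * (C * ((Real.exp x) ^ 2)⁻¹) := by
          gcongr; exact hC _ (Real.exp_pos _)
      _ = C * Real.exp (-(3 / 2) * x) := by
          rw [← Real.exp_nat_mul, ← Real.exp_neg, mul_left_comm, ← Real.exp_add]
          congr 2; push_cast; ring
      _ ≤ (C + D) * Real.exp (-|x|) := by
          rw [abs_of_nonneg hx]
          gcongr <;> linarith
  · calc _ ≤ Real.exp (x / 2) * (D * Real.exp x) := by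
          gcongr; exact hD _ (Real.exp_pos _)
      _ = D * Real.exp ((3 / 2) * x) := by
          rw [mul_left_comm, ← Real.exp_add]
          congr 2; ring
      _ ≤ (C + D) * Real.exp (-|x|) := by
          rw [abs_of_nonpos hx]
          gcongr <;> linarith

lemma zc_exp_summable (L : ℝ) (hL : 0 < L) : Summable fun k : ℤ => Real.exp (-|k * L|) := by
  have h : Summable fun n : ℕ => Real.exp (-((n : ℝ) * L)) := by
    have := summable_geometric_of_lt_one (Real.exp_pos (-L)).le (by rw [Real.exp_lt_one_iff]; linarith)
    refine this.congr fun n => ?_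
    rw [← Real.exp_nat_mul]; congr 1; ring
  refine Summable.of_nat_of_neg ?_ ?_
  · refine h.congr fun n => ?_
    rw [abs_of_nonneg (by positivity)]; simp
  · refine h.congr fun n => ?_
    push_cast
    rw [neg_mul, abs_neg, abs_of_nonneg (by positivity)]

lemma zcG_bound_local (f : SchwartzMap ℝ ℝ) (hf : f ∈ S0ev) :
    ∃ C : ℝ, 0 ≤ C ∧ ∀ (R L x : ℝ) (k : ℤ), |x| ≤ R →
      ‖zcG f (x + k * L)‖ ≤ C * Real.exp R * Real.exp (-|k * L|) := by
  obtain ⟨C, hC0, hC⟩ := zcG_bound f hf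
  refine ⟨C, hC0, fun R L x k hx => ?_⟩
  refine (hC _).trans ?_
  rw [mul_assoc, ← Real.exp_add]
  gcongr
  have : |k * L| ≤ |x + k * L| + |x| := by
    calc |k * L| = |(x + k * L) - x| := by ring_nf
      _ ≤ _ := abs_sub _ _
  linarith

lemma zcP_cont (L : ℝ) (hL : 0 < L) (f : SchwartzMap ℝ ℝ) (hf : f ∈ S0ev) :
    Continuous (zcP L f) := by
  obtain ⟨C, hC0, hC⟩ := zcG_bound_local f hf
  rw [continuous_iff_continuousAt]
  intro x
  have : ContinuousOn (zcP L f) (Ioo (-(|x| + 1)) (|x| + 1)) := by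
    refine continuousOn_tsum (u := fun k : ℤ => C * Real.exp (|x| + 1) * Real.exp (-|k * L|)) ?_
      ((zc_exp_summable L hL).mul_left _) ?_
    · intro k
      exact ((zcG_cont f).comp (by fun_prop)).continuousOn
    · intro k y hy
      exact hC _ L y k (abs_le.2 ⟨hy.1.le, hy.2.le⟩)
  refine this.continuousAt (Ioo_mem_nhds ?_ ?_)
  · linarith [neg_abs_le x]
  · linarith [le_abs_self x]

lemma zcP_periodic (L : ℝ) (f : SchwartzMap ℝ ℝ) : Function.Periodic (zcP L f) L := by
  intro x
  unfold zcP
  rw [← (Equiv.addRight (1 : ℤ)).tsum_eq (fun k : ℤ => zcG f (x + k * L))]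
  refine tsum_congr fun k => ?_
  simp only [Equiv.coe_addRight]
  push_cast
  congr 1; ring

lemma zc_integral_fold (L : ℝ) (hL : 0 < L) (φ : ℝ → ℂ) (hφ : Integrable φ) :
    HasSum (fun k : ℤ => ∫ x in (0 : ℝ)..L, φ (x + k * L)) (∫ x, φ x) := by
  have h1 : Integrable fun y => φ (L * y) := hφ.comp_mul_left' hL.ne'
  have h2 := (h1.hasSum_intervalIntegral_comp_add_int).const_smul L
  rw [Measure.integral_comp_mul_left, abs_of_pos (inv_pos.2 hL), smul_smul,
    mul_inv_cancel₀ hL.ne', one_smul] at h2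
  suffices hk : (fun k : ℤ => ∫ x in (0 : ℝ)..L, φ (x + k * L)) =
      fun k : ℤ => L • ∫ x in (0 : ℝ)..1, φ (L * (x + k)) by
    rw [hk]; exact h2
  refine funext fun k => ?_
  have := intervalIntegral.smul_integral_comp_mul_left (a := 0) (b := 1)
    (fun x : ℝ => φ (x + k * L)) L
  rw [mul_zero, mul_one] at this
  rw [← this]
  congr 2
  ext y
  congr 1; ring

lemma zc_integrable_exp : Integrable fun x : ℝ => Real.exp (-|x|) := by
  have h1 : IntegrableOn (fun x : ℝ => Real.exp (-|x|)) (Ioi 0) := by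
    refine (integrableOn_exp_neg_Ioi 0).congr_fun (fun x hx => ?_) measurableSet_Ioi
    simp only [abs_of_pos (show 0 < x from hx)]
  have h2 : IntegrableOn (fun x : ℝ => Real.exp (-|x|)) (Iic 0) := by
    refine (integrableOn_exp_Iic 0).congr_fun (fun x hx => ?_) measurableSet_Iic
    simp only [abs_of_nonpos (show x ≤ 0 from hx), neg_neg]
  rw [← integrableOn_univ, ← Iic_union_Ioi (a := (0 : ℝ))]
  exact h2.union h1

lemma zcG_integrable (f : SchwartzMap ℝ ℝ) (hf : f ∈ S0ev) : Integrable (zcG f) := by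
  obtain ⟨C, hC0, hC⟩ := zcG_bound f hf
  refine Integrable.mono' (zc_integrable_exp.const_mul C) (zcG_cont f).aestronglyMeasurable ?_
  exact Filter.Eventually.of_forall hC

lemma zc_unfold (L : ℝ) (hL : 0 < L) (f : SchwartzMap ℝ ℝ) (hf : f ∈ S0ev) (s : ℝ) (n : ℤ)
    (hs : s * L = 2 * Real.pi * n) :
    ∫ x in (0 : ℝ)..L, cexp (I * s * x) * (zcP L f x : ℂ) = ∫ x : ℝ, cexp (I * s * x) * (zcG f x : ℂ) := by
  have hnorm : ∀ x : ℝ, ‖cexp (I * s * x)‖ = 1 := by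
    intro x
    rw [Complex.norm_exp]; simp
  have hper : ∀ (x : ℝ) (k : ℤ), cexp (I * s * ((x + k * L : ℝ) : ℂ)) = cexp (I * s * x) := by
    intro x k
    have : I * s * ((x + k * L : ℝ) : ℂ) = I * s * x + ((k * n : ℤ) : ℂ) * (2 * Real.pi * I) := by
      have hs' : (s : ℂ) * L = 2 * Real.pi * n := by exact_mod_cast hs
      push_cast
      linear_combination I * k * hs'
    rw [this, Complex.exp_add, Complex.exp_int_mul_two_pi_mul_I, mul_one]
  have hIntg : Integrable fun x : ℝ => cexp (I * s * x) * (zcG f x : ℂ) := by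
    refine Integrable.bdd_mul (c := 1) (zcG_integrable f hf).ofReal ?_ ?_
    · exact (by fun_prop : Continuous fun x : ℝ => cexp (I * s * x)).aestronglyMeasurable
    · exact Filter.Eventually.of_forall fun x => (hnorm x).le
  have h1 := zc_integral_fold L hL _ hIntg
  obtain ⟨C, hC0, hC⟩ := zcG_bound_local f hf
  have hcont : ∀ k : ℤ, Continuous fun x : ℝ => cexp (I * s * x) * (zcG f (x + k * L) : ℂ) := by
    intro k
    refine Continuous.mul (by fun_prop) (Complex.continuous_ofReal.comp ((zcG_cont f).comp (by fun_prop)))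
  have h2 := intervalIntegral.hasSum_integral_of_dominated_convergence (μ := volume) (a := 0) (b := L)
    (F := fun (k : ℤ) (x : ℝ) => cexp (I * s * x) * (zcG f (x + k * L) : ℂ))
    (f := fun x => cexp (I * s * x) * (zcP L f x : ℂ))
    (fun k _ => C * Real.exp L * Real.exp (-|k * L|)) (fun k => (hcont k).aestronglyMeasurable) ?_ ?_ ?_ ?_
  · simp only [hper] at h1
    exact h2.unique h1
  · intro k
    refine Filter.Eventually.of_forall fun x hx => ?_
    rw [norm_mul, hnorm, one_mul, Complex.norm_real]
    refine hC L L x k ?_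
    rw [uIoc_of_le hL.le] at hx
    rw [abs_of_pos hx.1]; exact hx.2
  · exact Filter.Eventually.of_forall fun x hx => (zc_exp_summable L hL).mul_left _
  · simp
  · refine Filter.Eventually.of_forall fun x hx => ?_
    refine HasSum.mul_left _ ?_
    have : Summable fun k : ℤ => zcG f (x + k * L) :=
      Summable.of_norm_bounded ((zc_exp_summable L hL).mul_left _) (fun k => hC _ L x k le_rfl)
    exact Complex.hasSum_ofReal.2 this.hasSum

lemma zc_mellin_log (f : SchwartzMap ℝ ℝ) (s : ℝ) :
    ∫ x : ℝ, cexp (I * s * x) * (zcG f x : ℂ) = mellin (fun u => (zcF f u : ℂ)) (1 / 2 + I * s) := by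
  rw [mellin_eq_fourier, Real.fourier_real_eq_integral_exp_smul, ← integral_neg_eq_self]
  congr 1
  ext x
  have h1 : ((1 / 2 + I * s : ℂ)).re = 1 / 2 := by simp
  have h2 : ((1 / 2 + I * s : ℂ)).im = s := by simp
  rw [h1, h2]
  unfold zcG
  simp only [smul_eq_mul, Complex.real_smul]
  push_cast
  congr 1
  · congr 1
    have : (Real.pi : ℂ) ≠ 0 := by exact_mod_cast Real.pi_ne_zero
    field_simp
  · congr 2; ring_nf

lemma zc_key (L : ℝ) (hL : 0 < L) (f : SchwartzMap ℝ ℝ) (hf : f ∈ S0ev) (s : ℝ) (n : ℤ)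
    (hs : s * L = 2 * Real.pi * n) :
    ∫ x in (0 : ℝ)..L, cexp (I * s * x) * (zcP L f x : ℂ) =
      riemannZeta (1 / 2 + I * s) * mellin (fun u => (f u : ℂ)) (1 / 2 + I * s) := by
  rw [zc_unfold L hL f hf s n hs, zc_mellin_log, zc_mellin f hf]
  · simp
  · simp; norm_num
  · intro h
    have := congrArg Complex.re h
    norm_num at this

lemma zc_measure (L : ℝ) : mulHaarOn (Real.exp L) =
    Measure.map Real.exp (volume.restrict (Ioc 0 L)) := by
  have himg : Real.exp '' (Ioc 0 L) = Ioc 1 (Real.exp L) := by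
    ext u
    constructor
    · rintro ⟨x, hx, rfl⟩
      exact ⟨by simpa using hx.1, by simpa using hx.2⟩
    · rintro ⟨h1, h2⟩
      have h0 : 0 < u := by linarith
      exact ⟨Real.log u, ⟨Real.log_pos h1, (Real.log_le_iff_le_exp h0).2 h2⟩, Real.exp_log h0⟩
  ext t ht
  rw [Measure.map_apply Real.measurable_exp ht, mulHaarOn, withDensity_apply _ ht,
    ← lintegral_indicator ht, ← himg,
    lintegral_image_eq_lintegral_abs_deriv_mul measurableSet_Ioc
      (fun x _ => (Real.hasDerivAt_exp x).hasDerivWithinAt) Real.exp_injective.injOn,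
    ← lintegral_indicator_one (Real.measurable_exp ht)]
  refine lintegral_congr fun x => ?_
  by_cases hx : Real.exp x ∈ t
  · rw [indicator_of_mem hx, indicator_of_mem (show x ∈ Real.exp ⁻¹' t from hx),
      ← ENNReal.ofReal_mul (abs_nonneg _), abs_of_pos (Real.exp_pos x),
      mul_inv_cancel₀ (Real.exp_pos x).ne']
    simp
  · rw [indicator_of_notMem hx, indicator_of_notMem (show x ∉ Real.exp ⁻¹' t from hx), mul_zero]

lemma zc_exp_emb : MeasurableEmbedding Real.exp :=
  Real.continuous_exp.measurableEmbedding Real.exp_injective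

open MeasureTheory Set Complex
open scoped FourierTransform SchwartzMap Topology

lemma zc_backward (L : ℝ) (hL : 0 < L) (s : ℝ) (hz : riemannZeta (1 / 2 + I * s) = 0) (n : ℤ)
    (hs : s * L = 2 * Real.pi * n) : IsZetaCycle (Real.exp L) := by
  have hfin : IsFiniteMeasure (mulHaarOn (Real.exp L)) := by
    rw [zc_measure]; infer_instance
  set h : ℝ → ℂ := fun u => cexp (-(I * s * Real.log u)) with hh
  have hnorm : ∀ u, ‖h u‖ = 1 := by
    intro u
    simp only [hh]
    rw [Complex.norm_exp]; simp
  have hm : Measurable h := by fun_prop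
  have hmem : MemLp h 2 (mulHaarOn (Real.exp L)) :=
    MemLp.of_bound hm.aestronglyMeasurable 1 (Filter.Eventually.of_forall fun u => (hnorm u).le)
  refine ⟨hmem.toLp h, ?_, ?_⟩
  · intro h0
    have h1 : h =ᵐ[mulHaarOn (Real.exp L)] 0 := by
      have h3 := hmem.coeFn_toLp
      rw [h0] at h3
      exact h3.symm.trans (Lp.coeFn_zero _ _ _)
    have h2 : ∀ᵐ u ∂(mulHaarOn (Real.exp L)), False := by
      filter_upwards [h1] with u hu
      have := hnorm u
      rw [hu] at this
      simp at this
    rw [zc_measure, zc_exp_emb.ae_map_iff] at h2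
    rw [ae_iff] at h2
    simp only [not_false_eq_true, setOf_true, Measure.restrict_apply_univ, Real.volume_Ioc,
      sub_zero, ENNReal.ofReal_eq_zero] at h2
    linarith
  · intro f hf
    have e1 : ∫ u, (starRingEnd ℂ) ((hmem.toLp h) u) * (SigmaE (Real.exp L) f u : ℂ)
        ∂(mulHaarOn (Real.exp L)) =
        ∫ u, (starRingEnd ℂ) (h u) * (SigmaE (Real.exp L) f u : ℂ) ∂(mulHaarOn (Real.exp L)) := by
      refine integral_congr_ae ?_
      filter_upwards [hmem.coeFn_toLp] with u hu
      rw [hu]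
    rw [e1, zc_measure, zc_exp_emb.integral_map]
    have e2 := zc_key L hL f hf s n hs
    rw [hz, zero_mul, intervalIntegral.integral_of_le hL.le] at e2
    rw [← e2]
    congr 1
    ext x
    rw [zc_SigmaE]
    congr 1
    simp only [hh]
    rw [← Complex.exp_conj, Real.log_exp]
    simp

lemma zc_core (L : ℝ) (hL : 0 < L) (γ : ℝ → ℂ) (hγ : MemLp γ 2 (volume.restrict (Ioc 0 L)))
    (P : ℝ → ℂ) (hP : Continuous P) (hper : Function.Periodic P L)
    (h : ∀ y, ∫ x in Ioc 0 L, γ x * P (x + y) = 0)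
    (hc : ∀ n : ℤ, ∫ x in (0 : ℝ)..L, cexp (I * ((2 * Real.pi * n / L : ℝ) : ℂ) * x) * P x ≠ 0) :
    γ =ᵐ[volume.restrict (Ioc 0 L)] 0 := by
  have hγ1 : Integrable γ (volume.restrict (Ioc 0 L)) := hγ.integrable (by norm_num)
  have hcoef : ∀ n : ℤ, fourierCoeffOn hL γ n = 0 := by
    intro n
    set s : ℝ := 2 * Real.pi * n / L with hs
    set e : ℝ → ℂ := fun x => cexp (I * s * x) with he
    have hec : Continuous e := by simp only [he]; fun_prop
    have hePper : Function.Periodic (fun x => e x * P x) L := by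
      intro x
      simp only [hper x, he]
      congr 1
      have : I * s * ((x + L : ℝ) : ℂ) = I * s * x + (n : ℂ) * (2 * Real.pi * I) := by
        have hL' : (L : ℂ) ≠ 0 := by exact_mod_cast hL.ne'
        simp only [hs]
        push_cast
        field_simp
      rw [this, Complex.exp_add, Complex.exp_int_mul_two_pi_mul_I, mul_one]
    set c : ℂ := ∫ x in (0 : ℝ)..L, e x * P x with hcdef
    have hc0 : c ≠ 0 := hc n
    have inner : ∀ x, ∫ y in Ioc 0 L, e y * (γ x * P (x + y)) = γ x * e (-x) * c := by
      intro x
      rw [← intervalIntegral.integral_of_le hL.le]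
      have h1 : ∀ y, e y * (γ x * P (x + y)) = (γ x * e (-x)) * (e (x + y) * P (x + y)) := by
        intro y
        have : e y = e (-x) * e (x + y) := by
          simp only [he]
          rw [← Complex.exp_add]
          congr 1; push_cast; ring
        rw [this]; ring
      simp only [h1]
      rw [intervalIntegral.integral_const_mul,
        intervalIntegral.integral_comp_add_left (fun v => e v * P v) x]
      congr 1
      rw [add_zero, hePper.intervalIntegral_add_eq x 0, zero_add]
    have hPb : ∃ M, ∀ x, ‖P x‖ ≤ M := by
      obtain ⟨M, hM⟩ := (isCompact_Icc (a := (0 : ℝ)) (b := L)).exists_bound_of_continuousOn hP.continuousOn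
      refine ⟨M, fun x => ?_⟩
      obtain ⟨y, hy, hxy⟩ := hper.exists_mem_Ico₀ hL x
      rw [hxy]
      exact hM y ⟨hy.1, hy.2.le⟩
    obtain ⟨M, hM⟩ := hPb
    have hIntg : Integrable (Function.uncurry fun (x y : ℝ) => e y * (γ x * P (x + y)))
        ((volume.restrict (Ioc 0 L)).prod (volume.restrict (Ioc 0 L))) := by
      have h1 : Integrable (fun p : ℝ × ℝ => γ p.1)
          ((volume.restrict (Ioc 0 L)).prod (volume.restrict (Ioc 0 L))) := hγ1.comp_fst _
      have h2 : Integrable (fun p : ℝ × ℝ => (e p.2 * P (p.1 + p.2)) * γ p.1)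
          ((volume.restrict (Ioc 0 L)).prod (volume.restrict (Ioc 0 L))) := by
        refine Integrable.bdd_mul (c := M) h1 ?_ ?_
        · exact (by fun_prop : Continuous fun p : ℝ × ℝ => e p.2 * P (p.1 + p.2)).aestronglyMeasurable
        · refine Filter.Eventually.of_forall fun p => ?_
          have : ‖e p.2‖ = 1 := by simp only [he]; rw [Complex.norm_exp]; simp
          rw [norm_mul, this, one_mul]
          exact hM _
      refine h2.congr (Filter.Eventually.of_forall fun p => ?_)
      simp only [Function.uncurry]; ring
    have hswap := integral_integral_swap hIntg
    simp only [inner] at hswap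
    have hz : ∀ y, ∫ x in Ioc 0 L, e y * (γ x * P (x + y)) = 0 := by
      intro y
      rw [integral_const_mul, h, mul_zero]
    simp only [hz, integral_zero] at hswap
    rw [integral_mul_const] at hswap
    have hz2 := (mul_eq_zero.1 hswap).resolve_right hc0
    rw [fourierCoeffOn_eq_integral, intervalIntegral.integral_of_le hL.le]
    have : ∀ x : ℝ, (fourier (-n) (x : AddCircle (L - 0)) : ℂ) • γ x = γ x * e (-x) := by
      intro x
      rw [fourier_coe_apply, smul_eq_mul, mul_comm]
      simp only [he, hs]
      congr 2
      push_cast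
      rw [sub_zero]; ring
    simp only [this, hz2, smul_zero]
  have hs := hasSum_sq_fourierCoeffOn hL hγ
  have hs0 : HasSum (fun i : ℤ => ‖fourierCoeffOn hL γ i‖ ^ 2) 0 := by
    simp only [hcoef, norm_zero, ne_eq, OfNat.ofNat_ne_zero, not_false_eq_true, zero_pow]
    exact hasSum_zero
  have h0 := hs.unique hs0
  rw [smul_eq_mul, intervalIntegral.integral_of_le hL.le] at h0
  have h1 := (mul_eq_zero.1 h0).resolve_left (inv_ne_zero (by linarith))
  rw [integral_eq_zero_iff_of_nonneg (fun x => by positivity)] at h1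
  · filter_upwards [h1] with x hx
    simpa using hx
  · exact hγ.integrable_norm_pow (by norm_num)

lemma zcScale_mem (a : ℝˣ) (f : SchwartzMap ℝ ℝ) (hf : f ∈ S0ev) :
    zcScale a f ∈ S0ev := by
  obtain ⟨he, h0, hi⟩ := hf
  refine ⟨fun x => by simp [zcScale_apply, he], by simp [zcScale_apply, h0], ?_⟩
  simp only [zcScale_apply]
  rw [Measure.integral_comp_mul_right (fun x => f x), hi, smul_zero]

lemma zcP_scale (L : ℝ) (f : SchwartzMap ℝ ℝ) (y : ℝ) (a : ℝˣ) (ha : (a : ℝ) = Real.exp y) (x : ℝ) :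
    zcP L f (x + y) = Real.exp (y / 2) * zcP L (zcScale a f) x := by
  unfold zcP zcG zcF
  rw [← tsum_mul_left]
  refine tsum_congr fun k => ?_
  simp only [zcScale_apply, ha]
  rw [← mul_assoc, ← Real.exp_add]
  congr 1
  · congr 1; ring
  · refine tsum_congr fun n => ?_
    rw [mul_assoc, ← Real.exp_add]
    congr 3; ring

lemma zc_forward (L : ℝ) (hL : 0 < L) (f : SchwartzMap ℝ ℝ) (hf : f ∈ S0ev)
    (hM : ∀ s : ℝ, mellin (fun u => (f u : ℂ)) (1 / 2 + I * s) ≠ 0)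
    (h : IsZetaCycle (Real.exp L)) :
    ∃ s : ℝ, riemannZeta (1 / 2 + I * s) = 0 ∧ ∃ n : ℤ, s * L = 2 * Real.pi * n := by
  by_contra! hcon
  obtain ⟨g, hg0, hg⟩ := h
  refine hg0 ?_
  have hmem : MemLp (fun u => (starRingEnd ℂ) (g u)) 2 (mulHaarOn (Real.exp L)) :=
    (Lp.memLp g).star
  rw [Lp.eq_zero_iff_ae_eq_zero]
  clear hg0
  obtain ⟨φ, hφ⟩ : ∃ φ : ℝ → ℂ, φ = g := ⟨_, rfl⟩
  rw [← hφ] at hg hmem ⊢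
  clear hφ
  clear g
  rw [zc_measure, zc_exp_emb.memLp_map_measure_iff] at hmem
  have hz := zc_core L hL _ hmem (fun x => (zcP L f x : ℂ))
    (Complex.continuous_ofReal.comp (zcP_cont L hL f hf))
    (fun x => by simp only [zcP_periodic L f x]) ?_ ?_
  · rw [zc_measure]
    refine (zc_exp_emb.ae_map_iff).2 ?_
    filter_upwards [hz] with x hx
    simpa using hx
  · intro y
    obtain ⟨a, ha⟩ : ∃ a : ℝˣ, (a : ℝ) = Real.exp y := ⟨Units.mk0 _ (Real.exp_pos y).ne', rfl⟩
    have h1 := hg (zcScale a f) (zcScale_mem a f hf)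
    rw [zc_measure, zc_exp_emb.integral_map] at h1
    simp only [zc_SigmaE] at h1
    rw [← mul_zero (Real.exp (y / 2) : ℂ), ← h1, ← integral_const_mul]
    congr 1
    ext x
    rw [zcP_scale L f y a ha]
    simp only [Function.comp]
    push_cast
    ring
  · intro n
    have hs : (2 * Real.pi * n / L) * L = 2 * Real.pi * n := by field_simp
    rw [zc_key L hL f hf _ n hs]
    exact mul_ne_zero (fun h0 => hcon _ h0 n hs) (hM _)

open MeasureTheory Set Complex
open scoped FourierTransform SchwartzMap Topology ContDiff

lemma zc_pow_gauss (m : ℕ) : ∃ C : ℝ, ∀ x : ℝ, |x| ^ m * Real.exp (-(x ^ 2 / 2)) ≤ C := by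
  refine ⟨1 + 2 ^ m * m.factorial, fun x => ?_⟩
  have h1 := Real.pow_div_factorial_le_exp (x ^ 2 / 2) (by positivity) m
  rw [div_le_iff₀ (by positivity), div_pow, div_le_iff₀ (by positivity)] at h1
  have h2 : |x| ^ m ≤ 1 + (x ^ 2) ^ m := by
    rw [← sq_abs, ← pow_mul, mul_comm 2 m, pow_mul]
    nlinarith [sq_nonneg (|x| ^ m - 1)]
  have h3 : 1 ≤ Real.exp (x ^ 2 / 2) := Real.one_le_exp (by positivity)
  rw [Real.exp_neg, ← div_eq_mul_inv, div_le_iff₀ (Real.exp_pos _)]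
  calc _ ≤ 1 + (x ^ 2) ^ m := h2
    _ ≤ Real.exp (x ^ 2 / 2) + Real.exp (x ^ 2 / 2) * m.factorial * 2 ^ m := add_le_add h3 h1
    _ = _ := by ring

lemma zc_poly_gauss (k : ℕ) (p : Polynomial ℤ) : ∃ C : ℝ, ∀ x : ℝ,
    |x| ^ k * (|Polynomial.aeval x p| * Real.exp (-(x ^ 2 / 2))) ≤ C := by
  induction p using Polynomial.induction_on' with
  | add p q hp hq =>
    obtain ⟨C, hC⟩ := hp
    obtain ⟨D, hD⟩ := hq
    refine ⟨C + D, fun x => ?_⟩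
    rw [map_add]
    calc _ ≤ |x| ^ k * ((|Polynomial.aeval x p| + |Polynomial.aeval x q|) * Real.exp (-(x ^ 2 / 2))) := by
          gcongr; exact abs_add_le _ _
      _ = _ := by ring
      _ ≤ C + D := add_le_add (hC x) (hD x)
  | monomial m a =>
    obtain ⟨C, hC⟩ := zc_pow_gauss (k + m)
    refine ⟨|(a : ℝ)| * C, fun x => ?_⟩
    rw [Polynomial.aeval_monomial, abs_mul, abs_pow]
    calc _ = |(a : ℝ)| * (|x| ^ (k + m) * Real.exp (-(x ^ 2 / 2))) := by
          simp only [eq_intCast]; ring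
      _ ≤ _ := by gcongr; exact hC x

/-- the Gaussian as a Schwartz function -/
noncomputable def zcGauss : SchwartzMap ℝ ℝ where
  toFun := fun y => Real.exp (-(y ^ 2 / 2))
  smooth' := by fun_prop
  decay' := by
    intro k n
    obtain ⟨C, hC⟩ := zc_poly_gauss k (Polynomial.hermite n)
    refine ⟨C, fun x => ?_⟩
    rw [norm_iteratedFDeriv_eq_norm_iteratedDeriv, iteratedDeriv_eq_iterate,
      Polynomial.deriv_gaussian_eq_hermite_mul_gaussian]
    refine le_trans (le_of_eq ?_) (hC x)
    simp

lemma zcGauss_apply (x : ℝ) : zcGauss x = Real.exp (-(x ^ 2 / 2)) := rfl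

/-- `x^j` times the Gaussian -/
noncomputable def zcPG (j : ℕ) : SchwartzMap ℝ ℝ := SchwartzMap.smulLeftCLM ℝ (fun x : ℝ => x ^ j) zcGauss

lemma zcPG_apply (j : ℕ) (x : ℝ) : zcPG j x = x ^ j * Real.exp (-(x ^ 2 / 2)) := by
  unfold zcPG
  rw [SchwartzMap.smulLeftCLM_apply_apply (by fun_prop)]
  rfl

/-- the test function -/
noncomputable def zcf0 : SchwartzMap ℝ ℝ := zcPG 4 - (3 : ℝ) • zcPG 2

lemma zcf0_apply (x : ℝ) : zcf0 x = zcPG 4 x - 3 * zcPG 2 x := by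
  simp [zcf0]

lemma zcf0_mem : zcf0 ∈ S0ev := by
  refine ⟨fun x => ?_, ?_, ?_⟩
  · simp only [zcf0_apply, zcPG_apply]
    have : (-x) ^ 4 = x ^ 4 := by ring
    simp [this]
  · simp [zcf0_apply, zcPG_apply]
  · refine integral_eq_zero_of_hasDerivAt_of_integrable (f := fun x => -zcPG 3 x) ?_
      zcf0.integrable (zcPG 3).integrable.neg
    intro x
    simp only [zcf0_apply, zcPG_apply]
    have h1 : HasDerivAt (fun x : ℝ => -(x ^ 2 / 2)) (-x) x := by
      have := ((hasDerivAt_pow 2 x).div_const 2).neg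
      exact this.congr_deriv (by norm_num)
    have h2 := (((hasDerivAt_pow 3 x).mul h1.exp)).neg
    exact h2.congr_deriv (by push_cast; ring)

lemma zc_mellin_PG (j : ℕ) (z : ℂ) (hz : 0 < z.re) :
    mellin (fun u => (zcPG j u : ℂ)) z =
      1 / 2 * ((2 : ℂ) ^ ((z + j) / 2) * Complex.Gamma ((z + j) / 2)) := by
  have h1 : mellin (fun u => (zcPG j u : ℂ)) z =
      mellin (fun u : ℝ => (u : ℂ) ^ (j : ℂ) • cexp (-(1 / 2 : ℝ) * ((u ^ (2 : ℝ) : ℝ) : ℂ))) z := by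
    congr 1
    ext u
    rw [zcPG_apply, Complex.cpow_natCast, smul_eq_mul, Real.rpow_two]
    push_cast
    congr 2
    ring
  rw [h1, mellin_cpow_smul, mellin_comp_rpow (fun u : ℝ => cexp (-(1 / 2 : ℝ) * (u : ℂ)))]
  have h2 : 0 < ((z + j) / 2 : ℂ).re := by
    have : ((z + j) / 2 : ℂ).re = (z.re + j) / 2 := by simp
    rw [this]; positivity
  have h3 := integral_cpow_mul_exp_neg_mul_Ioi h2 (by norm_num : (0 : ℝ) < 1 / 2)
  unfold mellin
  rw [abs_of_pos two_pos, Complex.real_smul]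
  push_cast at h3 ⊢
  simp only [smul_eq_mul, neg_mul] at h3 ⊢
  rw [h3]
  norm_num

lemma zcf0_mellin (s : ℝ) : mellin (fun u => (zcf0 u : ℂ)) (1 / 2 + I * s) ≠ 0 := by
  set z : ℂ := 1 / 2 + I * s with hz
  have hre : z.re = 1 / 2 := by simp [hz]
  have h0 : 0 < z.re := by rw [hre]; norm_num
  have h2 : z.re < 2 := by rw [hre]; norm_num
  have c4 := zcf_conv (zcPG 4) z h0 h2
  have c2 := (zcf_conv (zcPG 2) z h0 h2).const_smul (3 : ℂ)
  have e := (hasMellin_sub c4 c2).2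
  have e1 : (fun u => (zcf0 u : ℂ)) = fun u => (zcPG 4 u : ℂ) - (3 : ℂ) • (zcPG 2 u : ℂ) := by
    ext u
    rw [zcf0_apply]; push_cast; rfl
  rw [e1, e, mellin_const_smul, zc_mellin_PG 4 z h0, zc_mellin_PG 2 z h0]
  have hw : (z + (4 : ℕ)) / 2 = (z + (2 : ℕ)) / 2 + 1 := by push_cast; ring
  have hwre : 0 < ((z + (2 : ℕ)) / 2 : ℂ).re := by
    have : ((z + (2 : ℕ)) / 2 : ℂ).re = (z.re + 2) / 2 := by simp
    rw [this, hre]; norm_num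
  have hw0 : (z + (2 : ℕ)) / 2 ≠ 0 := by
    intro h; rw [h] at hwre; simp at hwre
  rw [hw, Complex.Gamma_add_one _ hw0, Complex.cpow_add _ _ two_ne_zero, Complex.cpow_one]
  have hG := Complex.Gamma_ne_zero_of_re_pos hwre
  have h2p : (2 : ℂ) ^ ((z + (2 : ℕ)) / 2) ≠ 0 := by simp [Complex.cpow_eq_zero_iff]
  have hz1 : z - 1 ≠ 0 := by
    intro h
    have := congrArg Complex.re h
    simp [hre] at this
    norm_num at this
  have : 1 / 2 * ((2 : ℂ) ^ ((z + (2 : ℕ)) / 2) * 2 * ((z + (2 : ℕ)) / 2 * Complex.Gamma ((z + (2 : ℕ)) / 2))) -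
      (3 : ℂ) • (1 / 2 * ((2 : ℂ) ^ ((z + (2 : ℕ)) / 2) * Complex.Gamma ((z + (2 : ℕ)) / 2))) =
      1 / 2 * ((2 : ℂ) ^ ((z + (2 : ℕ)) / 2) * Complex.Gamma ((z + (2 : ℕ)) / 2)) * (z - 1) := by
    rw [smul_eq_mul]; push_cast; ring
  rw [this]
  exact mul_ne_zero (mul_ne_zero (by norm_num) (mul_ne_zero h2p hG)) hz1


end

/-- `H(L) = (Σ_μ E(S₀^ev))^⊥ ⊂ L²(ℝ₊*/μ^ℤ)` with `μ = e^L` is nonzero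
(i.e. the circle of length `L` is a ζ-cycle) iff `sL ∈ 2πℤ` for some `s` with
`ζ(1/2+is) = 0`. -/
theorem stmt11 (L : ℝ) (hL : 0 < L) :
    IsZetaCycle (Real.exp L) ↔
      ∃ s : ℝ, riemannZeta (1 / 2 + Complex.I * s) = 0 ∧
        ∃ n : ℤ, s * L = 2 * Real.pi * n := by
  constructor
  · exact zc_forward L hL zcf0 zcf0_mem zcf0_mellin
  · rintro ⟨s, hz, n, hs⟩
    exact zc_backward L hL s hz n hs
end
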